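/- arXiv:0707.4349 — 2 statements merged into one kernel-verified Lean document; each statement's English description precedes it below -/
import Mathlib

section
/- Let E ⊆ ℂ and let h : Δ × E → ℂ be a holomorphic motion of E parametrized by the open unit disk Δ with base point 0. Then h extends to a holomorphic motion of the closure of E: there exists a holomorphic motion H : Δ × cl(E) → ℂ of cl(E) (the closure of E taken in ℂ) parametrized by Δ with base point 0 such that H(c, z) = h(c, z) for all c ∈ Δ and all z ∈ E. -/
/-- A holomorphic motion of a set `E ⊆ ℂ` parametrized by the open unit disk
with base point `0`. -/
def IsHolomorphicMotion (E : Set ℂ) (h : ℂ → ℂ → ℂ) : Prop :=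
  (∀ z ∈ E, h 0 z = z) ∧
  (∀ c ∈ Metric.ball (0 : ℂ) 1, Set.InjOn (fun z => h c z) E) ∧
  (∀ z ∈ E, DifferentiableOn ℂ (fun c => h c z) (Metric.ball (0 : ℂ) 1))

open Metric Set Filter Topology

theorem exists_differentiableOn_exp_eq {f : ℂ → ℂ} {R : ℝ} (hR : 0 < R)
    (hf : DifferentiableOn ℂ f (ball 0 R)) (hf0 : ∀ c ∈ ball (0 : ℂ) R, f c ≠ 0)
    {w : ℂ} (hw : Complex.exp w = f 0) :
    ∃ g : ℂ → ℂ, DifferentiableOn ℂ g (ball 0 R) ∧ g 0 = w ∧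
      ∀ c ∈ ball (0 : ℂ) R, Complex.exp (g c) = f c := by
  have hdf : DifferentiableOn ℂ (fun c => deriv f c / f c) (ball 0 R) :=
    (hf.deriv isOpen_ball).div hf hf0
  obtain ⟨G, hG⟩ := hdf.isExactOn_ball
  have h0 : (0 : ℂ) ∈ ball (0 : ℂ) R := mem_ball_self hR
  set g : ℂ → ℂ := fun c => G c - G 0 + w with hg
  have hgd : ∀ c ∈ ball (0 : ℂ) R, HasDerivAt g (deriv f c / f c) c := fun c hc =>
    ((hG c hc).sub_const _).add_const _
  refine ⟨g, fun c hc => (hgd c hc).differentiableAt.differentiableWithinAt, by simp [hg], ?_⟩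
  have hk : ∀ c ∈ ball (0 : ℂ) R,
      HasDerivAt (fun c => f c * Complex.exp (-g c)) 0 c := by
    intro c hc
    have h1 := (hf.differentiableAt (isOpen_ball.mem_nhds hc)).hasDerivAt.mul (hgd c hc).neg.cexp
    refine h1.congr_deriv ?_
    have := hf0 c hc
    field_simp
    ring
  intro c hc
  have h2 := (convex_ball (0 : ℂ) R).is_const_of_fderivWithin_eq_zero (𝕜 := ℂ)
    (f := fun c => f c * Complex.exp (-g c))
    (fun x hx => (hk x hx).differentiableAt.differentiableWithinAt)
    (fun x hx => by
      rw [fderivWithin_of_isOpen isOpen_ball hx, (hk x hx).hasFDerivAt.fderiv]; ext; simp) hc h0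
  have h3 : g 0 = w := by simp [hg]
  simp only [h3, ← hw, ← Complex.exp_add, add_neg_cancel, Complex.exp_zero] at h2
  rw [Complex.exp_neg] at h2
  field_simp at h2
  exact h2.symm

/-- A Harnack inequality for moduli of nonvanishing holomorphic functions. -/
theorem norm_div_le_rpow_of_ne_zero {g : ℂ → ℂ} {R r M : ℝ} (hr : r < R)
    (hg : DifferentiableOn ℂ g (ball 0 R)) (hg0 : ∀ c ∈ ball (0 : ℂ) R, g c ≠ 0)
    (hM : ∀ c ∈ ball (0 : ℂ) R, ‖g c‖ < M) {c : ℂ} (hc : ‖c‖ ≤ r) :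
    ‖g c‖ / M ≤ (‖g 0‖ / M) ^ ((1 - (r / R) ^ 2) / 4) ∧
    ‖g 0‖ / M ≤ (‖g c‖ / M) ^ ((1 - (r / R) ^ 2) / 4) := by
  have hr0 : 0 ≤ r := (norm_nonneg c).trans hc
  have hR : 0 < R := hr0.trans_lt hr
  have h0 : (0 : ℂ) ∈ ball (0 : ℂ) R := mem_ball_self hR
  have hcR : c ∈ ball (0 : ℂ) R := by simpa using hc.trans_lt hr
  have hMpos : 0 < M := (norm_nonneg _).trans_lt (hM 0 h0)
  obtain ⟨G, hG, -, hGe⟩ := exists_differentiableOn_exp_eq hR hg hg0 (Complex.exp_log (hg0 0 h0))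
  set K : ℂ → ℂ := fun c => Real.log M - G c with hK
  have hlog : ∀ c ∈ ball (0 : ℂ) R, (K c).re = - Real.log (‖g c‖ / M) := by
    intro c hc
    rw [← hGe c hc, Complex.norm_exp, Real.log_div (Real.exp_ne_zero _) hMpos.ne', Real.log_exp]
    simp [hK]
  have hKpos : ∀ c ∈ ball (0 : ℂ) R, 0 < (K c).re := by
    intro c hc
    rw [hlog c hc, neg_pos]
    exact Real.log_neg (div_pos (norm_pos_iff.2 (hg0 c hc)) hMpos)
      ((div_lt_one hMpos).2 (hM c hc))
  set k := starRingEnd ℂ (K 0) with hk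
  have hden : ∀ c ∈ ball (0 : ℂ) R, K c + k ≠ 0 := by
    intro c hc h
    have := congrArg Complex.re h
    simp [hk] at this
    linarith [hKpos c hc, hKpos 0 h0]
  have hid : ∀ c, ‖K c + k‖ ^ 2 - ‖K c - K 0‖ ^ 2 = 4 * (K c).re * (K 0).re := by
    intro c
    simp only [Complex.sq_norm, Complex.normSq_apply, hk, Complex.add_re, Complex.add_im,
      Complex.conj_re, Complex.conj_im, Complex.sub_re, Complex.sub_im]
    ring
  have hKd : DifferentiableOn ℂ K (ball 0 R) := hG.const_sub _
  have hsch := Complex.dist_le_div_mul_dist_of_mapsTo_ball (R₂ := 1)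
    (f := fun c => (K c - K 0) / (K c + k)) ((hKd.sub_const _).div (hKd.add_const _) hden)
    (fun x hx => by
      simp only [sub_self, zero_div, mem_closedBall, dist_zero_right, norm_div]
      refine div_le_one_of_le₀ (abs_le_of_sq_le_sq' ?_ (norm_nonneg _)).2 (norm_nonneg _)
      nlinarith [hid x, mul_pos (hKpos x hx) (hKpos 0 h0)]) hcR
  simp only [sub_self, zero_div, dist_zero_right, norm_div] at hsch
  rw [div_le_iff₀ (norm_pos_iff.2 (hden c hcR))] at hsch
  have hs2 : ‖K c - K 0‖ ≤ r / R * ‖K c + k‖ := by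
    refine hsch.trans ?_
    gcongr
    rw [div_mul_eq_mul_div, one_mul]
    gcongr
  have hx := hKpos c hcR
  have hx0 := hKpos 0 h0
  have hre : (K c).re + (K 0).re ≤ ‖K c + k‖ := by
    simpa [hk] using Complex.re_le_norm (K c + k)
  have hρ : (r / R) ^ 2 < 1 := by
    rw [sq_lt_one_iff₀ (by positivity)]; exact (div_lt_one hR).2 hr
  have h1 : (1 - (r / R) ^ 2) * ((K c).re + (K 0).re) ^ 2 ≤ 4 * (K c).re * (K 0).re := by
    have h2 : ‖K c - K 0‖ ^ 2 ≤ (r / R) ^ 2 * ‖K c + k‖ ^ 2 := by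
      rw [← mul_pow]; gcongr
    have h3 : ((K c).re + (K 0).re) ^ 2 ≤ ‖K c + k‖ ^ 2 := by gcongr
    nlinarith [hid c]
  have key : ∀ x y : ℝ, 0 < x → 0 < y →
      (1 - (r / R) ^ 2) * (x + y) ^ 2 ≤ 4 * x * y → (1 - (r / R) ^ 2) / 4 * y ≤ x := by
    intro x y hx hy h
    refine le_of_mul_le_mul_right ?_ hy
    have : (1 - (r / R) ^ 2) * y ^ 2 ≤ (1 - (r / R) ^ 2) * (x + y) ^ 2 := by
      gcongr
      linarith
    linarith
  have hp : ∀ c ∈ ball (0 : ℂ) R, 0 < ‖g c‖ / M := fun c hc =>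
    div_pos (norm_pos_iff.2 (hg0 c hc)) hMpos
  have e1 := key _ _ hx hx0 h1
  have e2 := key _ _ hx0 hx (by linarith)
  rw [hlog c hcR, hlog 0 h0] at e1 e2
  constructor
  · rw [← Real.log_le_log_iff (hp c hcR) (Real.rpow_pos_of_pos (hp 0 h0) _),
      Real.log_rpow (hp 0 h0)]
    linarith
  · rw [← Real.log_le_log_iff (hp 0 h0) (Real.rpow_pos_of_pos (hp c hcR) _),
      Real.log_rpow (hp c hcR)]
    linarith

theorem exists_cosh_sq_eq_natCast_of_re_nonneg {w : ℂ} (hw : 0 ≤ w.re) :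
    ∃ p : ℂ, ‖p - w‖ < 3 ∧ ∃ n : ℕ, Complex.cosh p ^ 2 = n := by
  have hcont : ContinuousOn (fun x : ℝ => Real.cosh x ^ 2) (Icc w.re (w.re + 1)) :=
    (Real.continuous_cosh.pow 2).continuousOn
  have h1 : Real.cosh w.re ^ 2 + 1 ≤ Real.cosh (w.re + 1) ^ 2 := by
    rw [Real.cosh_add]
    have a1 := Real.one_le_cosh w.re
    have a2 : 1 ≤ Real.sinh 1 := Real.self_le_sinh_iff.2 zero_le_one
    have a3 := Real.cosh_sq 1
    have a4 : 0 ≤ Real.sinh w.re := Real.sinh_nonneg_iff.2 hw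
    have a5 : Real.cosh w.re * Real.cosh 1 ≤
      Real.cosh w.re * Real.cosh 1 + Real.sinh w.re * Real.sinh 1 := by
      have := mul_nonneg a4 (zero_le_one.trans a2); linarith
    have a6 : (Real.cosh w.re * Real.cosh 1) ^ 2 ≤
      (Real.cosh w.re * Real.cosh 1 + Real.sinh w.re * Real.sinh 1) ^ 2 := by
      have := Real.cosh_pos w.re
      have := Real.cosh_pos 1
      gcongr
    rw [mul_pow, a3] at a6
    have a7 : 1 ≤ Real.sinh 1 ^ 2 := one_le_pow₀ a2
    have a8 : 1 ≤ Real.cosh w.re ^ 2 := one_le_pow₀ a1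
    nlinarith
  obtain ⟨y, hy, hyn⟩ := intermediate_value_Icc (by linarith) hcont
    (show ((⌈Real.cosh w.re ^ 2⌉₊ : ℕ) : ℝ) ∈ _ from
      ⟨Nat.le_ceil _, (Nat.ceil_lt_add_one (sq_nonneg _)).le.trans h1⟩)
  simp only at hyn
  set k : ℤ := round (w.im / Real.pi)
  have hk : |w.im - k * Real.pi| ≤ Real.pi / 2 := by
    have := abs_sub_round (w.im / Real.pi)
    have h2 : w.im - k * Real.pi = (w.im / Real.pi - k) * Real.pi := by
      field_simp
    rw [h2, abs_mul, abs_of_pos Real.pi_pos]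
    nlinarith [Real.pi_pos]
  refine ⟨y + k * Real.pi * Complex.I, ?_, ⌈Real.cosh w.re ^ 2⌉₊, ?_⟩
  · refine (Complex.norm_le_abs_re_add_abs_im _).trans_lt ?_
    have e1 : |((y : ℂ) + k * Real.pi * Complex.I - w).re| ≤ 1 := by
      rw [abs_le]; constructor <;> simp <;> linarith [hy.1, hy.2]
    have e2 : |((y : ℂ) + k * Real.pi * Complex.I - w).im| ≤ Real.pi / 2 := by
      rw [abs_sub_comm] at hk
      simpa using hk
    linarith [Real.pi_lt_four]
  · rw [Complex.cosh_add, Complex.cosh_mul_I, Complex.sinh_mul_I, Complex.sin_int_mul_pi]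
    have : Complex.cos (k * Real.pi) ^ 2 = 1 := by
      have := Complex.sin_sq_add_cos_sq (k * Real.pi)
      rw [Complex.sin_int_mul_pi] at this
      simpa using this
    simp only [zero_mul, mul_zero, add_zero, mul_pow, this, mul_one]
    exact_mod_cast hyn

theorem exists_cosh_sq_eq_natCast (w : ℂ) :
    ∃ p : ℂ, ‖p - w‖ < 3 ∧ ∃ n : ℕ, Complex.cosh p ^ 2 = n := by
  rcases le_total 0 w.re with hw | hw
  · exact exists_cosh_sq_eq_natCast_of_re_nonneg hw
  · obtain ⟨p, hp, n, h⟩ := exists_cosh_sq_eq_natCast_of_re_nonneg (w := -w) (by simpa using hw)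
    refine ⟨-p, ?_, n, by simpa using h⟩
    rwa [← norm_neg, neg_sub, sub_neg_eq_add, add_comm, ← sub_neg_eq_add]

theorem ball_subset_image_of_norm_deriv_le {f : ℂ → ℂ} {a : ℂ} {t : ℝ} (ht : 0 < t)
    (hf : DifferentiableOn ℂ f (ball a t)) (ha : deriv f a ≠ 0)
    (hd : ∀ z ∈ ball a t, ‖deriv f z‖ ≤ 2 * ‖deriv f a‖) :
    ball (f a) (‖deriv f a‖ * t / 24) ⊆ f '' ball a t := by
  have hsub : closedBall a (t / 6) ⊆ ball a t := closedBall_subset_ball (by linarith)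
  have hda : ∀ z ∈ ball a t, DifferentiableAt ℂ f z := fun z hz =>
    hf.differentiableAt (isOpen_ball.mem_nhds hz)
  have hpos : 0 < ‖deriv f a‖ := norm_pos_iff.2 ha
  have h1 : ∀ z ∈ closedBall a (t / 6), ‖deriv f z - deriv f a‖ ≤ ‖deriv f a‖ / 2 := by
    intro z hz
    have := Complex.dist_le_div_mul_dist_of_mapsTo_ball (hf.deriv isOpen_ball)
      (R₂ := 3 * ‖deriv f a‖) (fun x hx => by
        rw [mem_closedBall, dist_eq_norm]
        exact (norm_sub_le _ _).trans (by linarith [hd x hx])) (hsub hz)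
    rw [dist_eq_norm] at this
    refine this.trans ?_
    calc _ ≤ 3 * ‖deriv f a‖ / t * (t / 6) := by gcongr; exact hz
      _ = _ := by field_simp; norm_num
  have h2 : ∀ z ∈ closedBall a (t / 6),
      ‖(f z - deriv f a * z) - (f a - deriv f a * a)‖ ≤ ‖deriv f a‖ / 2 * ‖z - a‖ := by
    intro z hz
    refine (convex_closedBall a (t / 6)).norm_image_sub_le_of_norm_hasDerivWithin_le
      (f := fun z => f z - deriv f a * z) (f' := fun z => deriv f z - deriv f a)
      (fun x hx => ?_) h1 (mem_closedBall_self (by positivity)) hz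
    exact (((hda x (hsub hx)).hasDerivAt.sub
      ((hasDerivAt_id x).const_mul (deriv f a))).congr_deriv (by simp)).hasDerivWithinAt
  have h3 : ∀ z ∈ sphere a (t / 6), ‖deriv f a‖ * t / 12 ≤ ‖f z - f a‖ := by
    intro z hz
    have h4 := h2 z (sphere_subset_closedBall hz)
    have hz' : ‖z - a‖ = t / 6 := by simpa [dist_eq_norm] using hz
    have h5 : ‖deriv f a * (z - a)‖ ≤ ‖f z - f a‖ +
        ‖(f z - deriv f a * z) - (f a - deriv f a * a)‖ := by
      have h6 : deriv f a * (z - a) =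
          (f z - f a) - ((f z - deriv f a * z) - (f a - deriv f a * a)) := by ring
      rw [h6]
      exact norm_sub_le _ _
    rw [norm_mul] at h5
    rw [hz'] at h4 h5
    linarith
  have h6 : ∃ᶠ z in 𝓝 a, f z ≠ f a := by
    intro h
    apply ha
    have h7 : f =ᶠ[𝓝 a] fun _ => f a := by simpa [EventuallyEq] using h
    rw [h7.deriv_eq]; simp
  have h8 := DiffContOnCl.ball_subset_image_closedBall
    ((hf.mono hsub).diffContOnCl_ball subset_rfl) (by positivity) h3 h6
  refine Subset.trans ?_ (h8.trans (image_mono hsub))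
  exact ball_subset_ball (by linarith)

theorem norm_deriv_mul_le_of_forall_exists_notMem_image {f : ℂ → ℂ} {c : ℂ} {r ρ : ℝ} (hr : 0 < r)
    {U : Set ℂ} (hU : IsOpen U) (hf : DifferentiableOn ℂ f U) (hcr : closedBall c r ⊆ U)
    (hρ : ∀ w, ∃ p, ‖p - w‖ < ρ ∧ p ∉ f '' U) :
    ‖deriv f c‖ * r ≤ 48 * ρ := by
  have hcont : ContinuousOn (fun z => ‖deriv f z‖ * (r - ‖z - c‖)) (closedBall c r) :=
    (((hf.deriv hU).continuousOn.mono hcr).norm).mul (by fun_prop)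
  obtain ⟨a, ha, hmax⟩ := (isCompact_closedBall c r).exists_isMaxOn
    ⟨c, mem_closedBall_self hr.le⟩ hcont
  have hc := hmax (mem_closedBall_self hr.le)
  simp only [sub_self, norm_zero, sub_zero, mem_ofPred_eq] at hc
  obtain ⟨p, hp, -⟩ := hρ 0
  have hρ0 : 0 < ρ := (norm_nonneg _).trans_lt hp
  have har : ‖a - c‖ ≤ r := by simpa [dist_eq_norm] using ha
  rcases har.eq_or_lt with h | h
  · rw [h, sub_self, mul_zero] at hc; linarith
  by_cases hda : deriv f a = 0
  · rw [hda, norm_zero, zero_mul] at hc; linarith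
  set t := (r - ‖a - c‖) / 2 with ht
  have htpos : 0 < t := by rw [ht]; linarith
  have htr : ∀ z ∈ ball a t, ‖z - c‖ ≤ r - t := by
    intro z hz
    have h1 : ‖z - a‖ < t := by simpa [dist_eq_norm] using hz
    have h2 := norm_add_le (z - a) (a - c)
    rw [sub_add_sub_cancel] at h2
    linarith
  have hsub : ball a t ⊆ U := fun z hz => hcr (by
    rw [mem_closedBall, dist_eq_norm]; linarith [htr z hz])
  have hb := ball_subset_image_of_norm_deriv_le htpos (hf.mono hsub) hda (fun z hz => by
    have h1 := hmax (show z ∈ closedBall c r by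
      rw [mem_closedBall, dist_eq_norm]; linarith [htr z hz])
    simp only [mem_ofPred_eq] at h1
    have h2 : ‖deriv f z‖ * t ≤ ‖deriv f z‖ * (r - ‖z - c‖) := by
      gcongr; linarith [htr z hz]
    refine le_of_mul_le_mul_right ?_ htpos
    have h3 : r - ‖a - c‖ = 2 * t := by rw [ht]; ring
    rw [h3] at h1
    linarith)
  obtain ⟨p, hp, hpU⟩ := hρ (f a)
  have h4 : ‖deriv f a‖ * t / 24 ≤ ρ := by
    by_contra! hlt
    exact hpU (image_mono hsub (hb (by rw [mem_ball, dist_eq_norm]; linarith)))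
  have h3 : r - ‖a - c‖ = 2 * t := by rw [ht]; ring
  rw [h3] at hc
  linarith

theorem norm_sub_le_of_forall_exists_notMem_image {f : ℂ → ℂ} {r ρ : ℝ} (hr : r < 1)
    (hf : DifferentiableOn ℂ f (ball 0 1))
    (hρ : ∀ w, ∃ p, ‖p - w‖ < ρ ∧ p ∉ f '' ball 0 1) {c : ℂ} (hc : ‖c‖ ≤ r) :
    ‖f c - f 0‖ ≤ 96 * ρ / (1 - r) := by
  have hr0 : 0 ≤ r := (norm_nonneg c).trans hc
  have hr1 : 0 < 1 - r := by linarith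
  obtain ⟨p, hp, -⟩ := hρ 0
  have hρ0 : 0 < ρ := (norm_nonneg _).trans_lt hp
  have hd : ∀ z ∈ closedBall (0 : ℂ) r, ‖deriv f z‖ ≤ 96 * ρ / (1 - r) := by
    intro z hz
    have h1 := norm_deriv_mul_le_of_forall_exists_notMem_image (c := z) (half_pos hr1) isOpen_ball hf
      (closedBall_subset_ball' (by linarith [mem_closedBall.1 hz])) hρ
    rw [le_div_iff₀ hr1]
    linarith
  have h2 := (convex_closedBall (0 : ℂ) r).norm_image_sub_le_of_norm_deriv_le
    (fun x hx => hf.differentiableAt (isOpen_ball.mem_nhds (closedBall_subset_ball hr hx))) hd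
    (mem_closedBall_self hr0) (by simpa using hc : c ∈ closedBall (0 : ℂ) r)
  refine h2.trans (mul_le_of_le_one_right (by positivity) ?_)
  simpa using hc.trans hr.le

theorem Complex.norm_log_le_abs_log_norm_add_pi (z : ℂ) :
    ‖Complex.log z‖ ≤ |Real.log ‖z‖| + Real.pi := by
  refine (Complex.norm_le_abs_re_add_abs_im _).trans ?_
  rw [Complex.log_re, Complex.log_im]
  gcongr
  exact Complex.abs_arg_le_pi z

theorem Complex.norm_cosh_le_exp_norm (z : ℂ) : ‖Complex.cosh z‖ ≤ Real.exp ‖z‖ := by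
  rw [Complex.cosh, norm_div, Complex.norm_ofNat, div_le_iff₀ two_pos]
  refine (norm_add_le _ _).trans ?_
  have h1 := Complex.norm_exp_le_exp_norm z
  have h2 := Complex.norm_exp_le_exp_norm (-z)
  rw [norm_neg] at h2
  linarith

theorem exists_differentiableOn_sq_eq {f : ℂ → ℂ} {R : ℝ} (hR : 0 < R)
    (hf : DifferentiableOn ℂ f (ball 0 R)) (hf0 : ∀ c ∈ ball (0 : ℂ) R, f c ≠ 0) :
    ∃ g : ℂ → ℂ, DifferentiableOn ℂ g (ball 0 R) ∧ ∀ c ∈ ball (0 : ℂ) R, g c ^ 2 = f c := by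
  obtain ⟨G, hG, -, hGe⟩ := exists_differentiableOn_exp_eq hR hf hf0
    (Complex.exp_log (hf0 0 (mem_ball_self hR)))
  refine ⟨fun c => Complex.exp (G c / 2), (hG.div_const 2).cexp, fun c hc => ?_⟩
  rw [← hGe c hc, ← Complex.exp_nat_mul]
  congr 1
  push_cast
  ring

theorem exists_differentiableOn_cosh_sq_eq {g : ℂ → ℂ} {R : ℝ} (hR : 0 < R)
    (hg : DifferentiableOn ℂ g (ball 0 R)) (hg0 : ∀ c ∈ ball (0 : ℂ) R, g c ≠ 0)
    (hg1 : ∀ c ∈ ball (0 : ℂ) R, g c ≠ 1) :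
    ∃ F : ℂ → ℂ, DifferentiableOn ℂ F (ball 0 R) ∧
      (∀ c ∈ ball (0 : ℂ) R, Complex.cosh (F c) ^ 2 = g c) ∧
      ‖F 0‖ ≤ Real.log (2 * ‖g 0‖ + 3) + Real.pi := by
  have h0 : (0 : ℂ) ∈ ball (0 : ℂ) R := mem_ball_self hR
  obtain ⟨u, hu, hug⟩ := exists_differentiableOn_sq_eq hR hg hg0
  obtain ⟨v, hv, hvg⟩ := exists_differentiableOn_sq_eq hR (hg.sub_const 1)
    (fun c hc => sub_ne_zero.2 (hg1 c hc))
  have huv : ∀ c ∈ ball (0 : ℂ) R, (u c - v c) * (u c + v c) = 1 := by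
    intro c hc
    linear_combination hug c hc - hvg c hc
  have hne : ∀ c ∈ ball (0 : ℂ) R, u c - v c ≠ 0 := fun c hc =>
    left_ne_zero_of_mul_eq_one (huv c hc)
  obtain ⟨F, hF, hF0, hFe⟩ := exists_differentiableOn_exp_eq hR (hu.sub hv) hne
    (Complex.exp_log (hne 0 h0))
  refine ⟨F, hF, fun c hc => ?_, ?_⟩
  · have h1 : Complex.exp (F c) = u c - v c := hFe c hc
    have h2 : Complex.exp (-F c) = u c + v c := by
      rw [Complex.exp_neg, h1]
      exact inv_eq_of_mul_eq_one_right (huv c hc)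
    rw [Complex.cosh, h1, h2, ← hug c hc]
    ring
  · rw [hF0]
    refine (Complex.norm_log_le_abs_log_norm_add_pi _).trans ?_
    gcongr
    have hu0 : ‖u 0‖ ^ 2 = ‖g 0‖ := by rw [← norm_pow, hug 0 h0]
    have hv0 : ‖v 0‖ ^ 2 ≤ ‖g 0‖ + 1 := by
      rw [← norm_pow, hvg 0 h0]
      simpa using norm_sub_le (g 0) 1
    have hs : ‖u 0‖ + ‖v 0‖ ≤ 2 * ‖g 0‖ + 3 := by
      nlinarith [sq_nonneg (‖u 0‖ - 1), sq_nonneg (‖v 0‖ - 1)]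
    have hpos : 0 < ‖u 0 - v 0‖ := norm_pos_iff.2 (hne 0 h0)
    have hm : ‖u 0 - v 0‖ * ‖u 0 + v 0‖ = 1 := by rw [← norm_mul, huv 0 h0, norm_one]
    have hpos' : 0 < ‖u 0 + v 0‖ := pos_of_mul_pos_right (by rw [hm]; exact one_pos) hpos.le
    have hl : Real.log ‖u 0 - v 0‖ + Real.log ‖u 0 + v 0‖ = 0 := by
      rw [← Real.log_mul hpos.ne' hpos'.ne', hm, Real.log_one]
    have h1 := Real.log_le_log hpos ((norm_sub_le _ _).trans hs)
    have h2 := Real.log_le_log hpos' ((norm_add_le _ _).trans hs)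
    show |Real.log ‖u 0 - v 0‖| ≤ _
    rw [abs_le]
    constructor <;> linarith

/-- A qualitative form of **Schottky's theorem**. -/
theorem exists_norm_le_of_ne_zero_of_ne_one {m M r : ℝ} (hm : 0 < m) (hr : r < 1) :
    ∃ C : ℝ, ∀ f : ℂ → ℂ, DifferentiableOn ℂ f (ball 0 1) →
      (∀ c ∈ ball (0 : ℂ) 1, f c ≠ 0) → (∀ c ∈ ball (0 : ℂ) 1, f c ≠ 1) →
      m ≤ ‖f 0‖ → ‖f 0‖ ≤ M → ∀ c, ‖c‖ ≤ r → ‖f c‖ ≤ C := by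
  set B : ℝ := |Real.log m| + |Real.log M| + Real.pi with hB
  set D : ℝ := Real.log (2 * B + 3) + Real.pi + 96 * 3 / (1 - r) with hD
  refine ⟨Real.exp (2 * Real.pi * Real.exp D ^ 2), fun f hf hf0 hf1 hmf hfM c hc => ?_⟩
  have h0 : (0 : ℂ) ∈ ball (0 : ℂ) 1 := mem_ball_self one_pos
  have hcb : c ∈ ball (0 : ℂ) 1 := by simpa using hc.trans_lt hr
  have hpi : (2 * Real.pi * Complex.I : ℂ) ≠ 0 := Complex.two_pi_I_ne_zero
  obtain ⟨L, hL, hL0, hLe⟩ := exists_differentiableOn_exp_eq one_pos hf hf0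
    (Complex.exp_log (hf0 0 h0))
  set g : ℂ → ℂ := fun c => L c / (2 * Real.pi * Complex.I) with hg
  have hgZ : ∀ c ∈ ball (0 : ℂ) 1, ∀ n : ℤ, g c ≠ n := by
    intro c hc n h
    apply hf1 c hc
    rw [← hLe c hc, Complex.exp_eq_one_iff]
    exact ⟨n, (div_eq_iff hpi).1 h⟩
  have hnorm : ‖(2 * Real.pi * Complex.I : ℂ)‖ = 2 * Real.pi := by
    simp [abs_of_pos Real.pi_pos]
  have hg0 : ‖g 0‖ ≤ B := by
    have h1 : ‖L 0‖ ≤ B := by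
      rw [hL0]
      refine (Complex.norm_log_le_abs_log_norm_add_pi _).trans ?_
      have h2 := Real.log_le_log hm hmf
      have h3 := Real.log_le_log (hm.trans_le hmf) hfM
      rw [hB]
      refine add_le_add_left (abs_le.2 ?_) _
      constructor
      · linarith [neg_abs_le (Real.log m), abs_nonneg (Real.log M)]
      · linarith [le_abs_self (Real.log M), abs_nonneg (Real.log m)]
    rw [hg, norm_div, hnorm]
    exact (div_le_self (norm_nonneg _) (by linarith [Real.pi_gt_three])).trans h1
  obtain ⟨F, hF, hFg, hF0⟩ := exists_differentiableOn_cosh_sq_eq one_pos (g := g) (hL.div_const _)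
    (fun c hc => by simpa using hgZ c hc 0) (fun c hc => by simpa using hgZ c hc 1)
  have hF1 := norm_sub_le_of_forall_exists_notMem_image (ρ := 3) hr hF (fun w => by
    obtain ⟨p, hp, n, hn⟩ := exists_cosh_sq_eq_natCast w
    refine ⟨p, hp, ?_⟩
    rintro ⟨c, hc, rfl⟩
    exact hgZ c hc n (by rw [← hFg c hc]; exact_mod_cast hn)) hc
  have hFD : ‖F c‖ ≤ D := by
    have h1 := norm_sub_norm_le (F c) (F 0)
    have h2 : Real.log (2 * ‖g 0‖ + 3) ≤ Real.log (2 * B + 3) := by gcongr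
    rw [hD]
    linarith
  have hgc : ‖g c‖ ≤ Real.exp D ^ 2 := by
    rw [← hFg c hcb, norm_pow]
    gcongr
    exact (Complex.norm_cosh_le_exp_norm _).trans (by gcongr)
  have hLc : L c = 2 * Real.pi * Complex.I * g c := (mul_div_cancel₀ _ hpi).symm
  rw [← hLe c hcb]
  refine (Complex.norm_exp_le_exp_norm _).trans ?_
  rw [hLc, norm_mul, hnorm]
  gcongr

theorem DifferentiableOn.exists_norm_le_of_norm_le {f : ℂ → ℂ} {r R : ℝ} (hr : r < R)
    (hf : DifferentiableOn ℂ f (ball 0 R)) : ∃ C, ∀ c, ‖c‖ ≤ r → ‖f c‖ ≤ C := by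
  obtain ⟨C, hC⟩ := (isCompact_closedBall (0 : ℂ) r).exists_bound_of_continuousOn
    (hf.continuousOn.mono (closedBall_subset_ball hr))
  exact ⟨C, fun c hc => hC c (by simpa using hc)⟩

namespace IsHolomorphicMotion

variable {E : Set ℂ} {h : ℂ → ℂ → ℂ}

theorem sub_ne_zero (hh : IsHolomorphicMotion E h) {z w c : ℂ} (hz : z ∈ E) (hw : w ∈ E)
    (hzw : z ≠ w) (hc : c ∈ ball (0 : ℂ) 1) : h c z - h c w ≠ 0 := fun h0 =>
  hzw (hh.2.1 c hc hz hw (_root_.sub_eq_zero.1 h0))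

theorem exists_norm_le (hh : IsHolomorphicMotion E h) {z₀ : ℂ} (hz : z₀ ∈ closure E)
    (hzE : z₀ ∉ E) :
    ∃ ε > 0, ∀ r < 1, ∃ C, ∀ w ∈ E, dist w z₀ < ε → ∀ c, ‖c‖ ≤ r → ‖h c w‖ ≤ C := by
  have hpos : ∀ w ∈ E, 0 < dist w z₀ := fun w hw => dist_pos.2 (ne_of_mem_of_not_mem hw hzE)
  obtain ⟨a, ha⟩ : E.Nonempty := closure_nonempty_iff.1 ⟨z₀, hz⟩
  obtain ⟨b, hb, hba⟩ := Metric.mem_closure_iff.1 hz _ (hpos a ha)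
  rw [dist_comm] at hba
  have hab : b ≠ a := by rintro rfl; exact hba.false
  have hε : 0 < dist b z₀ / 2 := half_pos (hpos b hb)
  have hn : 0 < ‖b - a‖ := norm_pos_iff.2 (_root_.sub_ne_zero.2 hab)
  refine ⟨dist b z₀ / 2, hε, fun r hr => ?_⟩
  obtain ⟨C, hC⟩ := exists_norm_le_of_ne_zero_of_ne_one (M := (dist b z₀ / 2 + dist a z₀) / ‖b - a‖)
    (div_pos hε hn) hr
  obtain ⟨A, hA⟩ := (hh.2.2 a ha).exists_norm_le_of_norm_le hr
  obtain ⟨B, hB⟩ := (hh.2.2 b hb).exists_norm_le_of_norm_le hr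
  refine ⟨C * (B + A) + A, fun w hw hwz c hc => ?_⟩
  have hwa : w ≠ a := by rintro rfl; linarith
  have hwb : w ≠ b := by rintro rfl; linarith
  have h0 : (0 : ℂ) ∈ ball (0 : ℂ) 1 := mem_ball_self one_pos
  have hcb : c ∈ ball (0 : ℂ) 1 := by simpa using hc.trans_lt hr
  have hq := hC (fun c => (h c w - h c a) / (h c b - h c a))
    (((hh.2.2 w hw).sub (hh.2.2 a ha)).div ((hh.2.2 b hb).sub (hh.2.2 a ha))
      fun c hc => hh.sub_ne_zero hb ha hab hc)
    (fun c hc => div_ne_zero (hh.sub_ne_zero hw ha hwa hc) (hh.sub_ne_zero hb ha hab hc))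
    (fun c hc h1 => hh.sub_ne_zero hw hb hwb hc (by
      rw [div_eq_one_iff_eq (hh.sub_ne_zero hb ha hab hc)] at h1
      linear_combination h1))
    (by
      simp only [hh.1 w hw, hh.1 a ha, hh.1 b hb, norm_div]
      gcongr
      rw [← dist_eq_norm]
      linarith [dist_triangle_left a z₀ w])
    (by
      simp only [hh.1 w hw, hh.1 a ha, hh.1 b hb, norm_div]
      gcongr
      rw [← dist_eq_norm]
      linarith [dist_triangle_right w a z₀])
    c hc
  have hC0 : 0 ≤ C := (norm_nonneg _).trans hq
  have hba' := hh.sub_ne_zero hb ha hab hcb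
  simp only [norm_div] at hq
  rw [div_le_iff₀ (norm_pos_iff.2 hba')] at hq
  have h1 : ‖h c b - h c a‖ ≤ B + A := (norm_sub_le _ _).trans (add_le_add (hB c hc) (hA c hc))
  have h2 := norm_sub_norm_le (h c w) (h c a)
  have h3 : C * ‖h c b - h c a‖ ≤ C * (B + A) := by gcongr
  linarith [hA c hc]

/-- Quantitative injectivity and equicontinuity of a holomorphic motion which is bounded near two
points. -/
theorem norm_sub_div_le_rpow (hh : IsHolomorphicMotion E h) {z w : ℂ} (hz : z ∈ E) (hw : w ∈ E)
    (hzw : z ≠ w) {r R C C' : ℝ} (hr : r < R) (hR : R < 1)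
    (hC : ∀ c, ‖c‖ ≤ R → ‖h c z‖ ≤ C) (hC' : ∀ c, ‖c‖ ≤ R → ‖h c w‖ ≤ C') {c : ℂ}
    (hc : ‖c‖ ≤ r) :
    ‖h c z - h c w‖ / (C + C' + 1) ≤
      (‖z - w‖ / (C + C' + 1)) ^ ((1 - (r / R) ^ 2) / 4) ∧
    ‖z - w‖ / (C + C' + 1) ≤
      (‖h c z - h c w‖ / (C + C' + 1)) ^ ((1 - (r / R) ^ 2) / 4) := by
  have hsub : ball (0 : ℂ) R ⊆ ball 0 1 := ball_subset_ball hR.le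
  have := norm_div_le_rpow_of_ne_zero (g := fun c => h c z - h c w) (M := C + C' + 1) hr
    (((hh.2.2 z hz).sub (hh.2.2 w hw)).mono hsub)
    (fun c hc => hh.sub_ne_zero hz hw hzw (hsub hc))
    (fun c hc => by
      have hc' : ‖c‖ ≤ R := by simpa using (mem_ball.1 hc).le
      linarith [norm_sub_le (h c z) (h c w), hC c hc', hC' c hc']) hc
  simpa only [hh.1 z hz, hh.1 w hw] using this

theorem one_sub_div_sq_pos {r R : ℝ} (hr0 : 0 ≤ r) (hr : r < R) : 0 < (1 - (r / R) ^ 2) / 4 := by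
  have hR : 0 < R := hr0.trans_lt hr
  have : (r / R) ^ 2 < 1 := by
    rw [sq_lt_one_iff₀ (by positivity)]; exact (div_lt_one hR).2 hr
  linarith

theorem uniformCauchySeqOn (hh : IsHolomorphicMotion E h) {z₀ : ℂ} (hz : z₀ ∈ closure E)
    (hzE : z₀ ∉ E) {r : ℝ} (hr0 : 0 ≤ r) (hr : r < 1) :
    UniformCauchySeqOn (fun z c => h c z) (𝓝[E] z₀) (closedBall 0 r) := by
  obtain ⟨ε, hε, hb⟩ := hh.exists_norm_le hz hzE
  obtain ⟨R, hrR, hR⟩ := exists_between hr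
  obtain ⟨C, hC⟩ := hb R hR
  have hκ := one_sub_div_sq_pos hr0 hrR
  set κ := (1 - (r / R) ^ 2) / 4
  have hev : ∀ᶠ z in 𝓝[E] z₀, z ∈ E ∧ dist z z₀ < ε :=
    eventually_mem_nhdsWithin.and (mem_nhdsWithin_of_mem_nhds (ball_mem_nhds z₀ hε))
  have : (𝓝[E] z₀).NeBot := mem_closure_iff_nhdsWithin_neBot.1 hz
  obtain ⟨z₁, hz₁, hz₁'⟩ := hev.exists
  have hM : 0 < C + C + 1 := by
    have := (norm_nonneg _).trans (hC z₁ hz₁ hz₁' 0 (by simpa using hr0.trans hrR.le))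
    linarith
  have hlim : Tendsto (fun p : ℂ × ℂ => (C + C + 1) * (‖p.1 - p.2‖ / (C + C + 1)) ^ κ)
      (𝓝[E] z₀ ×ˢ 𝓝[E] z₀) (𝓝 0) := by
    have h1 : Tendsto (fun p : ℂ × ℂ => p.1 - p.2) (𝓝[E] z₀ ×ˢ 𝓝[E] z₀) (𝓝 (z₀ - z₀)) :=
      (tendsto_fst.mono_right nhdsWithin_le_nhds).sub (tendsto_snd.mono_right nhdsWithin_le_nhds)
    have h2 := (((h1.norm.div_const (C + C + 1)).rpow_const (p := κ) (Or.inr hκ.le)).const_mul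
      (C + C + 1))
    simpa [Real.zero_rpow hκ.ne'] using h2
  intro u hu
  obtain ⟨δ, hδ, hδu⟩ := Metric.mem_uniformity_dist.1 hu
  filter_upwards [hev.prod_mk hev, hlim.eventually_lt_const hδ] with p ⟨hp1, hp2⟩ hpδ c hc
  apply hδu
  rcases eq_or_ne p.1 p.2 with heq | hne
  · simpa [heq] using hδ
  rw [dist_eq_norm]
  refine lt_of_le_of_lt ?_ hpδ
  have := (hh.norm_sub_div_le_rpow hp1.1 hp2.1 hne hrR hR (hC _ hp1.1 hp1.2) (hC _ hp2.1 hp2.2)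
    (by simpa using hc)).1
  rwa [div_le_iff₀' hM] at this

/-- Near each point of the closure, the motion has a holomorphic limit along some filter. -/
theorem exists_limit (hh : IsHolomorphicMotion E h) {z₀ : ℂ} (hz : z₀ ∈ closure E) :
    ∃ L : ℂ → ℂ, ∃ l : Filter ℂ, l.NeBot ∧ l ≤ 𝓝[E] z₀ ∧
      DifferentiableOn ℂ L (ball 0 1) ∧ (∀ c ∈ ball (0 : ℂ) 1, Tendsto (h c) l (𝓝 (L c))) ∧
      (z₀ ∈ E → ∀ c, L c = h c z₀) ∧
      ∀ r < 1, ∃ C, ∀ᶠ w in l, ∀ c, ‖c‖ ≤ r → ‖h c w‖ ≤ C := by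
  by_cases hzE : z₀ ∈ E
  · refine ⟨fun c => h c z₀, pure z₀, inferInstance, pure_le_nhdsWithin hzE, hh.2.2 z₀ hzE,
      fun c _ => tendsto_pure_nhds _ _, fun _ _ => rfl, fun r hr => ?_⟩
    simpa using (hh.2.2 z₀ hzE).exists_norm_le_of_norm_le hr
  have : (𝓝[E] z₀).NeBot := mem_closure_iff_nhdsWithin_neBot.1 hz
  have hlim : ∀ c : ℂ, ∃ y, c ∈ ball (0 : ℂ) 1 → Tendsto (h c) (𝓝[E] z₀) (𝓝 y) := by
    intro c
    by_cases hc : c ∈ ball (0 : ℂ) 1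
    · obtain ⟨y, hy⟩ := cauchy_iff_exists_le_nhds.1 ((hh.uniformCauchySeqOn hz hzE (norm_nonneg c)
        (by simpa using hc)).cauchy_map (show c ∈ closedBall (0 : ℂ) ‖c‖ by simp))
      exact ⟨y, fun _ => hy⟩
    · exact ⟨0, fun h => absurd h hc⟩
  choose L hL using hlim
  have hloc : TendstoLocallyUniformlyOn (fun z c => h c z) L (𝓝[E] z₀) (ball 0 1) := by
    rw [tendstoLocallyUniformlyOn_iff_forall_isCompact isOpen_ball]
    intro K hK hKc
    obtain ⟨r, hr, hKr⟩ : ∃ r ∈ Ico (0 : ℝ) 1, K ⊆ closedBall 0 r := by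
      rcases K.eq_empty_or_nonempty with rfl | hne
      · exact ⟨0, by simp, empty_subset _⟩
      obtain ⟨x, hx, hmax⟩ := hKc.exists_isMaxOn hne continuous_norm.continuousOn
      exact ⟨‖x‖, ⟨norm_nonneg x, by simpa using hK hx⟩, fun y hy => by simpa using hmax hy⟩
    exact ((hh.uniformCauchySeqOn hz hzE hr.1 hr.2).tendstoUniformlyOn_of_tendsto fun c hc =>
      hL c (closedBall_subset_ball hr.2 hc)).mono hKr
  obtain ⟨ε, hε, hb⟩ := hh.exists_norm_le hz hzE
  refine ⟨L, 𝓝[E] z₀, inferInstance, le_rfl, ?_, hL, fun h => absurd h hzE, fun r hr => ?_⟩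
  · refine hloc.differentiableOn ?_ isOpen_ball
    filter_upwards [eventually_mem_nhdsWithin] with z hz using hh.2.2 z hz
  · obtain ⟨C, hC⟩ := hb r hr
    refine ⟨C, ?_⟩
    filter_upwards [eventually_mem_nhdsWithin, mem_nhdsWithin_of_mem_nhds (ball_mem_nhds z₀ hε)]
      with w hw hwε using hC w hw hwε

end IsHolomorphicMotion

/-- The λ-lemma: a holomorphic motion of `E` extends to a holomorphic motion
of the closure of `E`. -/
theorem lambda_lemma (E : Set ℂ) (h : ℂ → ℂ → ℂ)
    (hh : IsHolomorphicMotion E h) :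
    ∃ H : ℂ → ℂ → ℂ, IsHolomorphicMotion (closure E) H ∧
      ∀ c ∈ Metric.ball (0 : ℂ) 1, ∀ z ∈ E, H c z = h c z := by
  choose! L l hne hle hd hlim hE hbd using fun z (hz : z ∈ closure E) => hh.exists_limit hz
  refine ⟨fun c z => L z c, ⟨fun z hz => ?_, fun c hc z hz w hw hzw => ?_, hd⟩,
    fun c _ z hz => hE z (subset_closure hz) hz c⟩
  · have := hne z hz
    refine tendsto_nhds_unique (hlim z hz 0 (mem_ball_self one_pos)) ?_
    refine (tendsto_id.mono_left ((hle z hz).trans nhdsWithin_le_nhds)).congr' ?_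
    filter_upwards [hle z hz eventually_mem_nhdsWithin] with x hx using (hh.1 x hx).symm
  · by_contra hzw'
    have := hne z hz
    have := hne w hw
    have hc1 : ‖c‖ < 1 := by simpa using hc
    obtain ⟨R, hcR, hR⟩ := exists_between hc1
    obtain ⟨C, hC⟩ := hbd z hz R hR
    obtain ⟨C', hC'⟩ := hbd w hw R hR
    have hκ := IsHolomorphicMotion.one_sub_div_sq_pos (norm_nonneg c) hcR
    set κ := (1 - (‖c‖ / R) ^ 2) / 4
    have hM : 0 < C + C' + 1 := by
      obtain ⟨x, hx⟩ := hC.exists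
      obtain ⟨y, hy⟩ := hC'.exists
      linarith [(norm_nonneg _).trans (hx c hcR.le), (norm_nonneg _).trans (hy c hcR.le)]
    have h1 : Tendsto (fun p : ℂ × ℂ => p.1 - p.2) (l z ×ˢ l w) (𝓝 (z - w)) :=
      (tendsto_fst.mono_right ((hle z hz).trans nhdsWithin_le_nhds)).sub
        (tendsto_snd.mono_right ((hle w hw).trans nhdsWithin_le_nhds))
    have h2 : Tendsto (fun p : ℂ × ℂ => h c p.1 - h c p.2) (l z ×ˢ l w) (𝓝 (L z c - L w c)) :=
      ((hlim z hz c hc).comp tendsto_fst).sub ((hlim w hw c hc).comp tendsto_snd)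
    have h3 := le_of_tendsto_of_tendsto (h1.norm.div_const (C + C' + 1))
      ((h2.norm.div_const (C + C' + 1)).rpow_const (p := κ) (Or.inr hκ.le)) (by
        filter_upwards [(hC.and (hle z hz eventually_mem_nhdsWithin)).prod_mk
          (hC'.and (hle w hw eventually_mem_nhdsWithin)),
          h1.eventually_ne (sub_ne_zero.2 hzw')] with p ⟨hp1, hp2⟩ hp
        exact (hh.norm_sub_div_le_rpow hp1.2 hp2.2 (sub_ne_zero.1 hp) hcR hR hp1.1 hp2.1 le_rfl).2)
    rw [show L z c = L w c from hzw, sub_self, norm_zero, zero_div, Real.zero_rpow hκ.ne'] at h3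
    exact (div_pos (norm_pos_iff.2 (sub_ne_zero.2 hzw')) hM).not_ge h3
end

section
/- Let E ⊆ ℂ and let h : Δ × E → ℂ be a holomorphic motion of E parametrized by the open unit disk Δ with base point 0. Then there exists a holomorphic motion H : Δ × ℂ → ℂ of the whole complex plane ℂ parametrized by Δ with base point 0 such that H(c, z) = h(c, z) for all c ∈ Δ and z ∈ E, and such that for each fixed c ∈ Δ the map z ↦ H(c, z) is a homeomorphism of ℂ onto itself. -/
section FiniteFamilies

open MeasureTheory Function

/-- A bounded measurable complex-valued function. -/
def IsBddMeas {X : Type*} [MeasurableSpace X] (f : X → ℂ) : Prop :=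
  Measurable f ∧ ∃ B, ∀ x, ‖f x‖ ≤ B

/-- An integral kernel whose integral operator is a Rota–Baxter operator of weight zero. -/
structure IsRotaBaxterKernel {X : Type*} [MeasurableSpace X] (μ : Measure X)
    (k : X → X → ℂ) (C : ℝ) : Prop where
  measurable : Measurable (uncurry k)
  integrable : ∀ z, Integrable (k z) μ
  integral_norm_le : ∀ z, ∫ ζ, ‖k z ζ‖ ∂μ ≤ C
  identity : ∀ z, ∀ᵐ ζ ∂μ, ∀ᵐ ω ∂μ, k z ζ * k z ω = k z ζ * k ζ ω + k z ω * k ω ζ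

/-- The integral operator with kernel `k`. -/
noncomputable def kernelOp {X : Type*} [MeasurableSpace X] (μ : Measure X) (k : X → X → ℂ)
    (f : X → ℂ) (z : X) : ℂ := ∫ ζ, k z ζ * f ζ ∂μ

namespace IsBddMeas

variable {X : Type*} [MeasurableSpace X] {f g : X → ℂ}

theorem const (w : ℂ) : IsBddMeas (fun _ : X => w) := ⟨measurable_const, ‖w‖, fun _ => le_rfl⟩

theorem add (hf : IsBddMeas f) (hg : IsBddMeas g) : IsBddMeas (fun x => f x + g x) := by
  obtain ⟨hf, A, hA⟩ := hf
  obtain ⟨hg, B, hB⟩ := hg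
  exact ⟨hf.add hg, A + B, fun x => (norm_add_le _ _).trans (add_le_add (hA x) (hB x))⟩

theorem mul (hf : IsBddMeas f) (hg : IsBddMeas g) : IsBddMeas (fun x => f x * g x) := by
  obtain ⟨hf, A, hA⟩ := hf
  obtain ⟨hg, B, hB⟩ := hg
  refine ⟨hf.mul hg, A * B, fun x => ?_⟩
  rw [norm_mul]
  exact mul_le_mul (hA x) (hB x) (norm_nonneg _) ((norm_nonneg _).trans (hA x))

theorem neg (hf : IsBddMeas f) : IsBddMeas (fun x => -f x) := by
  simpa using (const (-1)).mul hf

theorem sub (hf : IsBddMeas f) (hg : IsBddMeas g) : IsBddMeas (fun x => f x - g x) := by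
  simpa only [sub_eq_add_neg] using hf.add hg.neg

theorem pow (hf : IsBddMeas f) (n : ℕ) : IsBddMeas (fun x => f x ^ n) := by
  induction n with
  | zero => simpa using const (X := X) 1
  | succ n ih => simpa only [pow_succ] using ih.mul hf

theorem cexp (hf : IsBddMeas f) : IsBddMeas (fun x => Complex.exp (f x)) := by
  obtain ⟨hf, A, hA⟩ := hf
  refine ⟨hf.cexp, Real.exp A, fun x => ?_⟩
  rw [Complex.norm_exp]
  exact Real.exp_le_exp.2 ((Complex.re_le_norm _).trans (hA x))

end IsBddMeas

namespace IsRotaBaxterKernel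

variable {X : Type*} [MeasurableSpace X] {μ : Measure X} {k : X → X → ℂ} {C : ℝ}
  {f g α β : X → ℂ}

theorem integrable_mul (hk : IsRotaBaxterKernel μ k C) (hf : IsBddMeas f) (z : X) :
    Integrable (fun ζ => k z ζ * f ζ) μ := by
  obtain ⟨hf, B, hB⟩ := hf
  exact (hk.integrable z).mul_bdd hf.aestronglyMeasurable (Filter.Eventually.of_forall hB)

theorem norm_le (hk : IsRotaBaxterKernel μ k C) {B : ℝ} (hB : ∀ x, ‖f x‖ ≤ B) (z : X) :
    ‖kernelOp μ k f z‖ ≤ C * B := by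
  have hB0 : 0 ≤ B := (norm_nonneg _).trans (hB z)
  calc ‖kernelOp μ k f z‖ ≤ ∫ ζ, ‖k z ζ‖ * B ∂μ := by
        refine norm_integral_le_of_norm_le ((hk.integrable z).norm.mul_const B) ?_
        refine Filter.Eventually.of_forall fun ζ => ?_
        rw [norm_mul]
        exact mul_le_mul_of_nonneg_left (hB ζ) (norm_nonneg _)
    _ = (∫ ζ, ‖k z ζ‖ ∂μ) * B := integral_mul_const _ _
    _ ≤ C * B := mul_le_mul_of_nonneg_right (hk.integral_norm_le z) hB0

theorem isBddMeas [SFinite μ] (hk : IsRotaBaxterKernel μ k C) (hf : IsBddMeas f) :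
    IsBddMeas (kernelOp μ k f) := by
  obtain ⟨hm, B, hB⟩ := hf
  refine ⟨?_, C * B, hk.norm_le hB⟩
  have : Measurable (uncurry fun z ζ => k z ζ * f ζ) :=
    hk.measurable.mul (hm.comp measurable_snd)
  exact (this.stronglyMeasurable.integral_prod_right (ν := μ)).measurable

theorem map_add (hk : IsRotaBaxterKernel μ k C) (hf : IsBddMeas f) (hg : IsBddMeas g) (z : X) :
    kernelOp μ k (fun x => f x + g x) z = kernelOp μ k f z + kernelOp μ k g z := by
  simp only [kernelOp, mul_add]
  exact integral_add (hk.integrable_mul hf z) (hk.integrable_mul hg z)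

theorem map_sub (hk : IsRotaBaxterKernel μ k C) (hf : IsBddMeas f) (hg : IsBddMeas g) (z : X) :
    kernelOp μ k (fun x => f x - g x) z = kernelOp μ k f z - kernelOp μ k g z := by
  simp only [kernelOp, mul_sub]
  exact integral_sub (hk.integrable_mul hf z) (hk.integrable_mul hg z)

end IsRotaBaxterKernel

theorem kernelOp_const_mul {X : Type*} [MeasurableSpace X] (μ : Measure X) (k : X → X → ℂ)
    (c : ℂ) (f : X → ℂ) (z : X) :
    kernelOp μ k (fun x => c * f x) z = c * kernelOp μ k f z := by
  simp only [kernelOp, mul_left_comm _ c]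
  exact integral_const_mul _ _

namespace IsRotaBaxterKernel

variable {X : Type*} [MeasurableSpace X] {μ : Measure X} [SFinite μ] {k : X → X → ℂ} {C : ℝ}
  {f g α β : X → ℂ}

theorem integrable_prod (hk : IsRotaBaxterKernel μ k C) (hα : IsBddMeas α) (hβ : IsBddMeas β)
    (z : X) :
    Integrable (fun p : X × X => k z p.1 * α p.1 * (k p.1 p.2 * β p.2)) (μ.prod μ) := by
  have hm : Measurable (fun p : X × X => k z p.1 * α p.1 * (k p.1 p.2 * β p.2)) := by
    have h1 : Measurable (k z) := hk.measurable.comp measurable_prodMk_left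
    exact ((h1.comp measurable_fst).mul (hα.1.comp measurable_fst)).mul
      (hk.measurable.mul (hβ.1.comp measurable_snd))
  rw [integrable_prod_iff hm.aestronglyMeasurable]
  constructor
  · exact Filter.Eventually.of_forall fun ζ => (hk.integrable_mul hβ ζ).const_mul (k z ζ * α ζ)
  · obtain ⟨B, hB⟩ := hβ.2
    have hB0 : 0 ≤ B := (norm_nonneg _).trans (hB z)
    refine (((hk.integrable_mul hα z).norm).mul_const (C * B)).mono' ?_ ?_
    · exact (hm.norm.stronglyMeasurable.integral_prod_right (ν := μ)).aestronglyMeasurable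
    · refine Filter.Eventually.of_forall fun ζ => ?_
      rw [Real.norm_of_nonneg (integral_nonneg fun _ => norm_nonneg _)]
      simp only [norm_mul (k z ζ * α ζ)]
      rw [integral_const_mul]
      refine mul_le_mul_of_nonneg_left ?_ (norm_nonneg _)
      calc ∫ ω, ‖k ζ ω * β ω‖ ∂μ ≤ ∫ ω, ‖k ζ ω‖ * B ∂μ := by
            refine integral_mono (hk.integrable_mul hβ ζ).norm
              ((hk.integrable ζ).norm.mul_const B) fun ω => ?_
            simp only [norm_mul]
            exact mul_le_mul_of_nonneg_left (hB ω) (norm_nonneg _)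
        _ = (∫ ω, ‖k ζ ω‖ ∂μ) * B := integral_mul_const _ _
        _ ≤ C * B := mul_le_mul_of_nonneg_right (hk.integral_norm_le ζ) hB0

theorem integral_prod_eq (hk : IsRotaBaxterKernel μ k C) (hα : IsBddMeas α) (hβ : IsBddMeas β)
    (z : X) :
    ∫ p : X × X, k z p.1 * α p.1 * (k p.1 p.2 * β p.2) ∂(μ.prod μ) =
      kernelOp μ k (fun x => α x * kernelOp μ k β x) z := by
  rw [integral_prod _ (hk.integrable_prod hα hβ z)]
  simp only [kernelOp]
  refine integral_congr_ae (Filter.Eventually.of_forall fun ζ => ?_)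
  simp only [integral_const_mul, mul_assoc]

/-- The Rota–Baxter identity. -/
theorem mul_eq (hk : IsRotaBaxterKernel μ k C) (hα : IsBddMeas α) (hβ : IsBddMeas β) (z : X) :
    kernelOp μ k α z * kernelOp μ k β z =
      kernelOp μ k (fun x => α x * kernelOp μ k β x) z +
      kernelOp μ k (fun x => β x * kernelOp μ k α x) z := by
  rw [← hk.integral_prod_eq hα hβ, ← hk.integral_prod_eq hβ hα, ← integral_prod_swap
    (fun p : X × X => k z p.1 * β p.1 * (k p.1 p.2 * α p.2)),
    ← integral_add (hk.integrable_prod hα hβ z)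
      (by simpa only [comp_def] using (hk.integrable_prod hβ hα z).swap)]
  simp only [kernelOp]
  rw [← integral_prod_mul]
  have hm1 : Measurable (k z) := hk.measurable.comp measurable_prodMk_left
  have hm := hk.measurable
  have hαm := hα.1
  have hβm := hβ.1
  have hs : Measurable fun p : X × X => k p.2 p.1 := hm.comp measurable_swap
  have hs' : Measurable fun p : X × X => k p.1 p.2 := hm
  have key : ∀ᵐ p : X × X ∂(μ.prod μ),
      k z p.1 * k z p.2 = k z p.1 * k p.1 p.2 + k z p.2 * k p.2 p.1 := by
    refine (Measure.ae_prod_iff_ae_ae ?_).2 (hk.identity z)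
    exact measurableSet_eq_fun (by fun_prop) (by fun_prop)
  refine integral_congr_ae (key.mono fun p hp => ?_)
  simp only [Prod.swap]
  linear_combination α p.1 * β p.2 * hp

theorem kernelOp_mul_pow (hk : IsRotaBaxterKernel μ k C) (hα : IsBddMeas α) (n : ℕ) (z : X) :
    ((n : ℂ) + 1) * kernelOp μ k (fun x => α x * kernelOp μ k α x ^ n) z =
      kernelOp μ k α z ^ (n + 1) := by
  induction n generalizing z with
  | zero => simp
  | succ n ih =>
    have hs := hk.isBddMeas hα
    have h1 := hk.mul_eq hα (hα.mul (hs.pow n)) z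
    have h2 : kernelOp μ k (fun x => ((n : ℂ) + 1) *
        (α x * kernelOp μ k (fun x => α x * kernelOp μ k α x ^ n) x)) z =
        kernelOp μ k (fun x => α x * kernelOp μ k α x ^ (n + 1)) z := by
      congr 1
      ext x
      rw [← ih x]
      ring
    rw [kernelOp_const_mul] at h2
    have h3 : kernelOp μ k (fun x => α x * kernelOp μ k α x ^ n * kernelOp μ k α x) z =
        kernelOp μ k (fun x => α x * kernelOp μ k α x ^ (n + 1)) z := by
      simp only [pow_succ, mul_assoc]
    rw [h3] at h1
    rw [pow_succ, ← ih z]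
    push_cast
    linear_combination ((n : ℂ) + 1) * (-h1) - h2

theorem kernelOp_mul_exp (hk : IsRotaBaxterKernel μ k C) (hα : IsBddMeas α) (z : X) :
    kernelOp μ k (fun x => α x * Complex.exp (kernelOp μ k α x)) z =
      Complex.exp (kernelOp μ k α z) - 1 := by
  have hs := hk.isBddMeas hα
  obtain ⟨A, hA⟩ := hα.2
  obtain ⟨S, hS⟩ := hs.2
  set s := kernelOp μ k α with hsdef
  have hsum : HasSum (fun n : ℕ => ∫ ζ, k z ζ * (α ζ * (s ζ ^ n / n.factorial)) ∂μ)
      (∫ ζ, k z ζ * (α ζ * Complex.exp (s ζ)) ∂μ) := by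
    refine hasSum_integral_of_dominated_convergence
      (fun n ζ => ‖k z ζ‖ * (A * (S ^ n / n.factorial))) ?_ ?_ ?_ ?_ ?_
    · intro n
      have := (hk.integrable_mul (hα.mul ((hs.pow n).mul (IsBddMeas.const (1 / n.factorial)))) z)
      simpa only [mul_one_div] using this.aestronglyMeasurable
    · refine fun n => Filter.Eventually.of_forall fun ζ => ?_
      simp only [norm_mul, norm_div, norm_pow, Complex.norm_natCast]
      have := hA ζ
      have := hS ζ
      have := (norm_nonneg _).trans (hA ζ)
      gcongr
    · refine Filter.Eventually.of_forall fun ζ => ?_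
      exact ((Real.summable_pow_div_factorial S).mul_left A).mul_left _
    · have : (fun ζ => ∑' n : ℕ, ‖k z ζ‖ * (A * (S ^ n / n.factorial))) =
          fun ζ => ‖k z ζ‖ * (A * ∑' n : ℕ, (S ^ n / n.factorial)) := by
        ext ζ
        rw [tsum_mul_left, tsum_mul_left]
      rw [this]
      exact (hk.integrable z).norm.mul_const _
    · refine Filter.Eventually.of_forall fun ζ => ?_
      have := NormedSpace.expSeries_div_hasSum_exp (s ζ)
      rw [← Complex.exp_eq_exp_ℂ] at this
      exact (this.mul_left _).mul_left _
  have hterm : ∀ n : ℕ, ∫ ζ, k z ζ * (α ζ * (s ζ ^ n / n.factorial)) ∂μ =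
      s z ^ (n + 1) / (n + 1).factorial := by
    intro n
    have h1 := hk.kernelOp_mul_pow hα n z
    have h2 := kernelOp_const_mul μ k (1 / (n.factorial : ℂ)) (fun x => α x * s x ^ n) z
    have h3 : ∫ ζ, k z ζ * (α ζ * (s ζ ^ n / n.factorial)) ∂μ =
        kernelOp μ k (fun x => 1 / (n.factorial : ℂ) * (α x * s x ^ n)) z := by
      simp only [kernelOp]
      congr 1
      ext x
      ring
    rw [← hsdef] at h1
    rw [h3, h2, ← h1, Nat.factorial_succ]
    have : (n.factorial : ℂ) ≠ 0 := by exact_mod_cast n.factorial_ne_zero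
    have h4 : (n : ℂ) + 1 ≠ 0 := by exact_mod_cast n.succ_ne_zero
    push_cast
    field_simp
  simp only [hterm] at hsum
  have he := NormedSpace.expSeries_div_hasSum_exp (s z)
  rw [← Complex.exp_eq_exp_ℂ, ← hasSum_nat_add_iff' 1] at he
  simp at he
  exact hsum.unique he

end IsRotaBaxterKernel

namespace IsRotaBaxterKernel

variable {X : Type*} [MeasurableSpace X] {μ : Measure X} [SFinite μ] {k : X → X → ℂ} {C : ℝ}
  {α h u : X → ℂ}

/-- Variation of constants for the linear equation `u = h + T (α * u)`. -/
theorem exp_neg_mul_sub (hk : IsRotaBaxterKernel μ k C) (hα : IsBddMeas α) (hh : IsBddMeas h)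
    (hu : IsBddMeas u) (heq : ∀ z, u z = h z + kernelOp μ k (fun x => α x * u x) z) (z : X) :
    Complex.exp (-kernelOp μ k α z) * (u z - h z) =
      kernelOp μ k (fun x => α x * Complex.exp (-kernelOp μ k α x) * h x) z := by
  have hs := hk.isBddMeas hα
  have hneg : ∀ x, kernelOp μ k (fun y => -α y) x = -kernelOp μ k α x := fun x => by
    simpa using kernelOp_const_mul μ k (-1) α x
  have hexp : ∀ x, kernelOp μ k (fun y => -α y * Complex.exp (-kernelOp μ k α y)) x =
      Complex.exp (-kernelOp μ k α x) - 1 := fun x => by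
    have := hk.kernelOp_mul_exp hα.neg x
    simpa only [hneg] using this
  have he := hs.neg.cexp
  have h1 := hk.mul_eq (hα.neg.mul he) (hα.mul hu) z
  rw [hexp] at h1
  have hv : ∀ x, kernelOp μ k (fun x => α x * u x) x = u x - h x := fun x => by
    rw [heq x]; ring
  simp only [hexp, hv] at h1
  rw [← hk.map_add ((hα.neg.mul he).mul (hu.sub hh))
    ((hα.mul hu).mul (he.sub (IsBddMeas.const 1)))] at h1
  have h2 : kernelOp μ k (fun x => -α x * Complex.exp (-kernelOp μ k α x) * (u x - h x) +
      α x * u x * (Complex.exp (-kernelOp μ k α x) - 1)) z =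
      kernelOp μ k (fun x => α x * Complex.exp (-kernelOp μ k α x) * h x) z - (u z - h z) := by
    rw [← hv z, ← hk.map_sub ((hα.mul he).mul hh) (hα.mul hu)]
    congr 1
    ext x
    ring
  rw [h2] at h1
  linear_combination h1

/-- A solution of `u = w + T (α * u)` with constant `w` is `w * exp (T α)`. -/
theorem eq_mul_exp (hk : IsRotaBaxterKernel μ k C) (hα : IsBddMeas α)
    (hu : IsBddMeas u) {w : ℂ} (heq : ∀ z, u z = w + kernelOp μ k (fun x => α x * u x) z) (z : X) :
    u z = w * Complex.exp (kernelOp μ k α z) := by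
  have h1 := hk.exp_neg_mul_sub hα (IsBddMeas.const w) hu heq z
  have hneg : ∀ x, kernelOp μ k (fun y => -α y) x = -kernelOp μ k α x := fun x => by
    simpa using kernelOp_const_mul μ k (-1) α x
  have h2 := hk.kernelOp_mul_exp hα.neg z
  simp only [hneg] at h2
  have h3 : kernelOp μ k (fun x => α x * Complex.exp (-kernelOp μ k α x) * w) z =
      -w * (Complex.exp (-kernelOp μ k α z) - 1) := by
    rw [← h2, ← kernelOp_const_mul]
    congr 1
    ext x
    ring
  rw [h3, Complex.exp_neg] at h1
  have := Complex.exp_ne_zero (kernelOp μ k α z)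
  field_simp at h1
  linear_combination h1

/-- The a priori estimate for the linear equation `u = h + T (α * u)`. -/
theorem norm_le_of_eq (hk : IsRotaBaxterKernel μ k C) (hα : IsBddMeas α)
    (hh : IsBddMeas h) (hu : IsBddMeas u)
    (heq : ∀ z, u z = h z + kernelOp μ k (fun x => α x * u x) z) {K B : ℝ}
    (hK : ∀ x, ‖α x‖ ≤ K) (hB : ∀ x, ‖h x‖ ≤ B) (z : X) :
    ‖u z‖ ≤ (1 + C * K * Real.exp (2 * (C * K))) * B := by
  have hK0 : 0 ≤ K := (norm_nonneg _).trans (hK z)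
  have hB0 : 0 ≤ B := (norm_nonneg _).trans (hB z)
  have h1 := hk.exp_neg_mul_sub hα hh hu heq z
  have hs : ∀ x, ‖kernelOp μ k α x‖ ≤ C * K := hk.norm_le hK
  have hE : ∀ x, ‖Complex.exp (-kernelOp μ k α x)‖ ≤ Real.exp (C * K) := fun x => by
    rw [Complex.norm_exp]
    exact Real.exp_le_exp.2 ((Complex.re_le_norm _).trans (by simpa using hs x))
  have h2 : ‖kernelOp μ k (fun x => α x * Complex.exp (-kernelOp μ k α x) * h x) z‖ ≤
      C * (K * Real.exp (C * K) * B) := by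
    refine hk.norm_le (fun x => ?_) z
    rw [norm_mul, norm_mul]
    have := hK x
    have := hE x
    have := hB x
    gcongr
  have h3 : u z - h z = Complex.exp (kernelOp μ k α z) *
      kernelOp μ k (fun x => α x * Complex.exp (-kernelOp μ k α x) * h x) z := by
    rw [← h1, ← mul_assoc, ← Complex.exp_add]
    simp
  have h4 : ‖u z - h z‖ ≤ Real.exp (C * K) * (C * (K * Real.exp (C * K) * B)) := by
    rw [h3, norm_mul]
    refine mul_le_mul ?_ h2 (norm_nonneg _) (Real.exp_pos _).le
    rw [Complex.norm_exp]
    exact Real.exp_le_exp.2 ((Complex.re_le_norm _).trans (hs z))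
  have h5 : Real.exp (2 * (C * K)) = Real.exp (C * K) * Real.exp (C * K) := by
    rw [← Real.exp_add]; ring_nf
  calc ‖u z‖ = ‖h z + (u z - h z)‖ := by ring_nf
    _ ≤ ‖h z‖ + ‖u z - h z‖ := norm_add_le _ _
    _ ≤ B + Real.exp (C * K) * (C * (K * Real.exp (C * K) * B)) := add_le_add (hB z) h4
    _ = _ := by rw [h5]; ring

/-- The difference quotient of a Lipschitz function along two functions. -/
theorem exists_quotient {F : X → ℂ → ℂ} (hF : Measurable (uncurry F)) {K : ℝ} (hK : 0 ≤ K)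
    (hlip : ∀ x v w, ‖F x v - F x w‖ ≤ K * ‖v - w‖) {f g : X → ℂ} (hf : Measurable f)
    (hg : Measurable g) :
    ∃ α : X → ℂ, IsBddMeas α ∧ (∀ x, ‖α x‖ ≤ K) ∧
      ∀ x, F x (f x) - F x (g x) = α x * (f x - g x) := by
  have hle : ∀ x, ‖(F x (f x) - F x (g x)) / (f x - g x)‖ ≤ K := fun x => by
    rw [norm_div]
    exact div_le_of_le_mul₀ (norm_nonneg _) hK (hlip x _ _)
  have hFf : Measurable fun x => F x (f x) := hF.comp (measurable_id.prodMk hf)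
  have hFg : Measurable fun x => F x (g x) := hF.comp (measurable_id.prodMk hg)
  refine ⟨fun x => (F x (f x) - F x (g x)) / (f x - g x),
    ⟨(hFf.sub hFg).div (hf.sub hg), K, hle⟩, hle, fun x => ?_⟩
  rcases eq_or_ne (f x - g x) 0 with h0 | h0
  · rw [sub_eq_zero.1 h0]; simp
  · field_simp

/-- Step of the continuity method for the equation `g = h + t * T (F (·, g))`. -/
theorem exists_solution_step (hk : IsRotaBaxterKernel μ k C) {F : X → ℂ → ℂ}
    (hF : Measurable (uncurry F)) {B K : ℝ} (hB : ∀ x w, ‖F x w‖ ≤ B) (hK : 0 ≤ K)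
    (hlip : ∀ x v w, ‖F x v - F x w‖ ≤ K * ‖v - w‖) {t δ : ℝ} (ht : 0 ≤ t) (ht1 : t ≤ 1)
    (hδ : 0 ≤ δ) (hδ1 : (1 + C * K * Real.exp (2 * (C * K))) * (δ * (C * K)) ≤ 1 / 2)
    (hsol : ∀ h, IsBddMeas h → ∃ g, IsBddMeas g ∧
      ∀ z, g z = h z + t * kernelOp μ k (fun x => F x (g x)) z)
    (h : X → ℂ) (hh : IsBddMeas h) :
    ∃ g, IsBddMeas g ∧ ∀ z, g z = h z + (t + δ : ℝ) * kernelOp μ k (fun x => F x (g x)) z := by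
  have hFg : ∀ g : X → ℂ, Measurable g → IsBddMeas fun x => F x (g x) := fun g hg =>
    ⟨hF.comp (measurable_id.prodMk hg), B, fun x => hB x _⟩
  choose! S hS hSeq using hsol
  set N : (X → ℂ) → X → ℂ := fun g z => h z + δ * kernelOp μ k (fun x => F x (g x)) z with hN
  have hNb : ∀ g, Measurable g → IsBddMeas (N g) := fun g hg =>
    hh.add ((IsBddMeas.const (δ : ℂ)).mul (hk.isBddMeas (hFg g hg)))
  have hlipT : ∀ f g : X → ℂ, Measurable f → Measurable g → ∀ d, (∀ x, ‖f x - g x‖ ≤ d) → ∀ z,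
      ‖kernelOp μ k (fun x => F x (f x)) z - kernelOp μ k (fun x => F x (g x)) z‖ ≤
        C * (K * d) := by
    intro f g hf hg d hd z
    rw [← hk.map_sub (hFg f hf) (hFg g hg)]
    exact hk.norm_le (fun x => (hlip x _ _).trans (by have := hd x; gcongr)) z
  have hcontr : ∀ f g : X → ℂ, Measurable f → Measurable g → ∀ d, (∀ x, ‖f x - g x‖ ≤ d) →
      ∀ z, ‖S (N f) z - S (N g) z‖ ≤ 1 / 2 * d := by
    intro f g hf hg d hd z
    have hd0 : 0 ≤ d := (norm_nonneg _).trans (hd z)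
    have hSf := hS _ (hNb f hf)
    have hSg := hS _ (hNb g hg)
    obtain ⟨α, hα, hαK, hαeq⟩ := exists_quotient hF hK hlip hSf.1 hSg.1
    have hle : ∀ x, ‖(t : ℂ) * α x‖ ≤ K := fun x => by
      rw [norm_mul, Complex.norm_real, Real.norm_of_nonneg ht]
      calc t * ‖α x‖ ≤ 1 * K := by have := hαK x; gcongr
        _ = K := one_mul K
    have := hk.norm_le_of_eq (((IsBddMeas.const (t : ℂ))).mul hα)
      ((hNb f hf).sub (hNb g hg)) (hSf.sub hSg) (B := δ * (C * (K * d))) (fun x => ?_) hle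
      (fun x => ?_) z
    · refine this.trans ?_
      calc (1 + C * K * Real.exp (2 * (C * K))) * (δ * (C * (K * d)))
          = ((1 + C * K * Real.exp (2 * (C * K))) * (δ * (C * K))) * d := by ring
        _ ≤ 1 / 2 * d := by gcongr
    · have e : kernelOp μ k (fun x => (t : ℂ) * α x * (S (N f) x - S (N g) x)) x =
          t * (kernelOp μ k (fun x => F x (S (N f) x)) x -
            kernelOp μ k (fun x => F x (S (N g) x)) x) := by
        rw [← hk.map_sub (hFg _ hSf.1) (hFg _ hSg.1), ← kernelOp_const_mul]
        simp only [hαeq, mul_assoc]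
      rw [e]
      conv_lhs => rw [hSeq _ (hNb f hf) x, hSeq _ (hNb g hg) x]
      ring
    · have e : N f x - N g x = δ * (kernelOp μ k (fun x => F x (f x)) x -
          kernelOp μ k (fun x => F x (g x)) x) := by
        simp only [hN]; ring
      rw [e, norm_mul, Complex.norm_real, Real.norm_of_nonneg hδ]
      exact mul_le_mul_of_nonneg_left (hlipT f g hf hg d hd x) hδ
  set G : ℕ → X → ℂ := fun n => (fun g => S (N g))^[n] h with hG
  have hGs : ∀ n, G (n + 1) = S (N (G n)) := fun n => iterate_succ_apply' _ _ _
  have hGb : ∀ n, IsBddMeas (G n) := by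
    intro n
    induction n with
    | zero => exact hh
    | succ n ih => rw [hGs]; exact hS _ (hNb _ ih.1)
  obtain ⟨D, hD⟩ := ((hGb 1).sub (hGb 0)).2
  have hstep : ∀ n x, ‖G (n + 1) x - G n x‖ ≤ D * (1 / 2) ^ n := by
    intro n
    induction n with
    | zero => simpa using hD
    | succ n ih =>
      intro x
      rw [hGs (n + 1)]
      nth_rw 2 [hGs n]
      refine (hcontr _ _ (hGb _).1 (hGb _).1 _ ih x).trans (le_of_eq ?_)
      rw [pow_succ]; ring
  have hdist : ∀ x n, dist (G n x) (G (n + 1) x) ≤ D * (1 / 2) ^ n := fun x n => by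
    rw [dist_comm, dist_eq_norm]; exact hstep n x
  have hcau : ∀ x, ∃ l, Filter.Tendsto (fun n => G n x) Filter.atTop (nhds l) := fun x =>
    cauchySeq_tendsto_of_complete
      (cauchySeq_of_le_geometric (1 / 2) D (by norm_num) (hdist x))
  choose g hg using hcau
  have hgm : Measurable g := measurable_of_tendsto_metrizable (fun n => (hGb n).1)
    (tendsto_pi_nhds.2 hg)
  have hgd : ∀ n x, ‖G n x - g x‖ ≤ 2 * D * (1 / 2) ^ n := fun n x => by
    rw [← dist_eq_norm]
    refine (dist_le_of_le_geometric_of_tendsto (1 / 2) D (by norm_num) (hdist x) (hg x) n).trans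
      (le_of_eq ?_)
    ring
  have hgb : IsBddMeas g := by
    obtain ⟨A, hA⟩ := (hGb 0).2
    refine ⟨hgm, A + 2 * D, fun x => ?_⟩
    have h1 := hgd 0 x
    have h2 := hA x
    calc ‖g x‖ = ‖G 0 x - (G 0 x - g x)‖ := by ring_nf
      _ ≤ ‖G 0 x‖ + ‖G 0 x - g x‖ := norm_sub_le _ _
      _ ≤ A + 2 * D := by
        refine add_le_add h2 (h1.trans (le_of_eq ?_))
        simp
  have hT : ∀ z, Filter.Tendsto (fun n => kernelOp μ k (fun x => F x (G n x)) z) Filter.atTop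
      (nhds (kernelOp μ k (fun x => F x (g x)) z)) := by
    intro z
    rw [tendsto_iff_norm_sub_tendsto_zero]
    refine squeeze_zero (fun _ => norm_nonneg _)
      (fun n => hlipT _ _ (hGb n).1 hgm _ (hgd n) z) ?_
    have := (tendsto_pow_atTop_nhds_zero_of_lt_one (r := (1 / 2 : ℝ)) (by norm_num)
      (by norm_num)).const_mul (C * (K * (2 * D)))
    simpa only [mul_assoc, mul_zero] using this
  refine ⟨g, hgb, fun z => ?_⟩
  have h1 : Filter.Tendsto (fun n => G (n + 1) z) Filter.atTop (nhds (g z)) :=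
    (hg z).comp (Filter.tendsto_add_atTop_nat 1)
  have h2 : Filter.Tendsto (fun n => N (G n) z + t * kernelOp μ k (fun x => F x (G (n + 1) x)) z)
      Filter.atTop (nhds ((h z + δ * kernelOp μ k (fun x => F x (g x)) z) +
        t * kernelOp μ k (fun x => F x (g x)) z)) :=
    (((hT z).const_mul _).const_add _).add
      (((hT z).comp (Filter.tendsto_add_atTop_nat 1)).const_mul _)
  have h3 : ∀ n, G (n + 1) z = N (G n) z + t * kernelOp μ k (fun x => F x (G (n + 1) x)) z :=
    fun n => by
      simp only [hGs n]
      exact hSeq _ (hNb _ (hGb n).1) z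
  simp only [h3] at h1
  rw [tendsto_nhds_unique h1 h2]
  push_cast
  ring

/-- Solvability of `g = w + T (F (·, g))` for `F` bounded and Lipschitz in the second variable. -/
theorem exists_solution (hk : IsRotaBaxterKernel μ k C) (hC : 0 ≤ C) {F : X → ℂ → ℂ}
    (hF : Measurable (uncurry F)) {B K : ℝ} (hB : ∀ x w, ‖F x w‖ ≤ B) (hK : 0 ≤ K)
    (hlip : ∀ x v w, ‖F x v - F x w‖ ≤ K * ‖v - w‖) (w : ℂ) :
    ∃ g, IsBddMeas g ∧ ∀ z, g z = w + kernelOp μ k (fun x => F x (g x)) z := by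
  set L := (1 + C * K * Real.exp (2 * (C * K))) * (C * K) with hL
  have hL0 : 0 ≤ L := by positivity
  obtain ⟨n, hn⟩ := exists_nat_gt (2 * L)
  have hn0 : (0 : ℝ) < n := by linarith
  have hind : ∀ m : ℕ, m ≤ n → ∀ h, IsBddMeas h → ∃ g, IsBddMeas g ∧
      ∀ z, g z = h z + ((m / n : ℝ) : ℂ) * kernelOp μ k (fun x => F x (g x)) z := by
    intro m
    induction m with
    | zero => exact fun _ h hh => ⟨h, hh, fun z => by simp⟩
    | succ m ih =>
      intro hm h hh
      have := hk.exists_solution_step hF hB hK hlip (t := m / n) (δ := 1 / n) (by positivity)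
        ((div_le_one hn0).2 (by exact_mod_cast (Nat.le_succ m).trans hm)) (by positivity) ?_
        (ih ((Nat.le_succ m).trans hm)) h hh
      · have e : ((m + 1 : ℕ) / n : ℝ) = m / n + 1 / n := by push_cast; ring
        rw [e]
        exact this
      · have e : (1 + C * K * Real.exp (2 * (C * K))) * (1 / n * (C * K)) = L / n := by
          rw [hL]; ring
        rw [e, div_le_iff₀ hn0]
        linarith
  obtain ⟨g, hg, hgeq⟩ := hind n le_rfl _ (IsBddMeas.const w)
  refine ⟨g, hg, fun z => ?_⟩
  rw [div_self hn0.ne'] at hgeq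
  simpa using hgeq z

end IsRotaBaxterKernel

/-- The Wirtinger derivative `∂φ/∂z̄`. -/
noncomputable def dbar (φ : ℂ → ℂ) (z : ℂ) : ℂ :=
  (fderiv ℝ φ z 1 + Complex.I * fderiv ℝ φ z Complex.I) / 2

theorem continuous_dbar {φ : ℂ → ℂ} (hφ : ContDiff ℝ 1 φ) : Continuous (dbar φ) := by
  have := hφ.continuous_fderiv one_ne_zero
  unfold dbar
  fun_prop

theorem dbar_eq_zero {φ : ℂ → ℂ} {z : ℂ} (hφ : DifferentiableAt ℂ φ z) : dbar φ z = 0 := by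
  have h : fderiv ℝ φ z = (fderiv ℂ φ z).restrictScalars ℝ := hφ.fderiv_restrictScalars ℝ
  have h2 : fderiv ℂ φ z Complex.I = Complex.I * fderiv ℂ φ z 1 := by
    rw [← smul_eq_mul, ← map_smul]; simp
  simp only [dbar, h, ContinuousLinearMap.coe_restrictScalars', h2]
  linear_combination (fderiv ℂ φ z 1) / 2 * Complex.I_mul_I

section CauchyPompeiu

open Set Complex

variable {φ : ℂ → ℂ}

theorem integral_radial_deriv (hφ : ContDiff ℝ 1 φ) (hc : HasCompactSupport φ) (z : ℂ) (θ : ℝ) :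
    ∫ ρ in Ioi (0 : ℝ), fderiv ℝ φ (z + ρ * exp (θ * I)) (exp (θ * I)) = -φ z := by
  have hd : ∀ ρ : ℝ, HasDerivAt (fun ρ : ℝ => φ (z + ρ * exp (θ * I)))
      (fderiv ℝ φ (z + ρ * exp (θ * I)) (exp (θ * I))) ρ := by
    intro ρ
    have h1 : HasDerivAt (fun ρ : ℝ => z + ρ * exp (θ * I)) (exp (θ * I)) ρ := by
      simpa using ((hasDerivAt_id ρ).ofReal_comp.mul_const (exp (θ * I))).const_add z
    exact ((hφ.differentiable one_ne_zero _).hasFDerivAt).comp_hasDerivAt ρ h1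
  have hcs : HasCompactSupport (fun ρ : ℝ => φ (z + ρ * exp (θ * I))) := by
    refine hc.comp_isClosedEmbedding (g := fun ρ : ℝ => z + ρ * exp (θ * I)) ?_
    refine Isometry.isClosedEmbedding (Isometry.of_dist_eq fun a b => ?_)
    rw [dist_add_left, Complex.dist_eq, ← sub_mul, norm_mul, norm_exp_ofReal_mul_I, mul_one,
      ← ofReal_sub, norm_real, Real.dist_eq, Real.norm_eq_abs]
  have hder : deriv (fun ρ : ℝ => φ (z + ρ * exp (θ * I))) =
      fun ρ : ℝ => fderiv ℝ φ (z + ρ * exp (θ * I)) (exp (θ * I)) :=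
    funext fun ρ => (hd ρ).deriv
  have hcd : ContDiff ℝ 1 (fun ρ : ℝ => φ (z + ρ * exp (θ * I))) :=
    hφ.comp (contDiff_const.add (ofRealCLM.contDiff.mul contDiff_const))
  have := hcs.integral_Ioi_deriv_eq hcd 0
  rw [hder] at this
  simpa using this

theorem integral_angular_deriv (hφ : ContDiff ℝ 1 φ) (z : ℂ) {ρ : ℝ} (hρ : 0 < ρ) :
    ∫ θ in Ioo (-Real.pi) Real.pi, fderiv ℝ φ (z + ρ * exp (θ * I)) (I * exp (θ * I)) = 0 := by
  have hd : ∀ θ : ℝ, HasDerivAt (fun θ : ℝ => φ (z + ρ * exp (θ * I)))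
      (ρ * fderiv ℝ φ (z + ρ * exp (θ * I)) (I * exp (θ * I))) θ := by
    intro θ
    have h1 : HasDerivAt (fun θ : ℝ => z + ρ * exp (θ * I)) (ρ • (I * exp (θ * I))) θ := by
      have := (((hasDerivAt_id θ).ofReal_comp.mul_const I).cexp.const_mul (ρ : ℂ)).const_add z
      refine this.congr_deriv ?_
      simp only [id, real_smul, ofReal_one]
      ring
    have := ((hφ.differentiable one_ne_zero _).hasFDerivAt).comp_hasDerivAt θ h1
    rwa [map_smul, real_smul] at this
  have hcont : Continuous fun θ : ℝ =>
      (ρ : ℂ) * fderiv ℝ φ (z + ρ * exp (θ * I)) (I * exp (θ * I)) := by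
    have := hφ.continuous_fderiv one_ne_zero
    fun_prop
  have h := intervalIntegral.integral_eq_sub_of_hasDerivAt (a := -Real.pi) (b := Real.pi)
    (fun θ _ => hd θ) (hcont.intervalIntegrable _ _)
  rw [intervalIntegral.integral_const_mul,
    intervalIntegral.integral_of_le (by linarith [Real.pi_pos]), integral_Ioc_eq_integral_Ioo] at h
  have he : exp ((-Real.pi : ℝ) * I) = exp (Real.pi * I) := by
    rw [ofReal_neg, neg_mul, Complex.exp_neg, exp_pi_mul_I]; norm_num
  rw [he, sub_self] at h
  exact (mul_eq_zero.1 h).resolve_left (by exact_mod_cast hρ.ne')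

theorem integrableOn_polar_of_hasCompactSupport {ψ : ℂ → ℂ →L[ℝ] ℂ} (hψ : Continuous ψ)
    (hc : HasCompactSupport ψ) (z : ℂ) {e : ℝ → ℂ} (he : Continuous e) :
    IntegrableOn (fun p : ℝ × ℝ => ψ (z + p.1 * exp (p.2 * I)) (e p.2))
      (Ioi (0 : ℝ) ×ˢ Ioo (-Real.pi) Real.pi) := by
  obtain ⟨R, hR⟩ := hc.isCompact.isBounded.subset_closedBall z
  have hcont : Continuous fun p : ℝ × ℝ => ψ (z + p.1 * exp (p.2 * I)) (e p.2) := by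
    fun_prop
  have h1 : IntegrableOn (fun p : ℝ × ℝ => ψ (z + p.1 * exp (p.2 * I)) (e p.2))
      (Icc (0 : ℝ) R ×ˢ Icc (-Real.pi) Real.pi) :=
    hcont.continuousOn.integrableOn_compact (isCompact_Icc.prod isCompact_Icc)
  refine h1.of_forall_sdiff_eq_zero (measurableSet_Ioi.prod measurableSet_Ioo) ?_
  rintro ⟨ρ, θ⟩ ⟨⟨h2, h3⟩, h4⟩
  have h2 : 0 < ρ := h2
  have hρ : R < ρ := by
    by_contra hle
    exact h4 ⟨⟨h2.le, not_lt.1 hle⟩, ⟨h3.1.le, h3.2.le⟩⟩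
  have : ψ (z + ρ * exp (θ * I)) = 0 := by
    refine image_eq_zero_of_notMem_tsupport fun hmem => ?_
    have := hR hmem
    simp [norm_exp_ofReal_mul_I, abs_of_pos h2] at this
    linarith
  simp [this]

/-- The Cauchy–Pompeiu formula for compactly supported functions. -/
theorem integral_inv_sub_mul_dbar (hφ : ContDiff ℝ 1 φ) (hc : HasCompactSupport φ) (z : ℂ) :
    ∫ ζ, (z - ζ)⁻¹ * dbar φ ζ = Real.pi * φ z := by
  have hD := hφ.continuous_fderiv one_ne_zero
  have hDc : HasCompactSupport (fderiv ℝ φ) := hc.fderiv ℝ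
  rw [← integral_add_left_eq_self _ z, ← Complex.integral_comp_polarCoord_symm]
  have hA := integrableOn_polar_of_hasCompactSupport hD hDc z
    (e := fun θ => exp (θ * I)) (by fun_prop)
  have hB := integrableOn_polar_of_hasCompactSupport hD hDc z
    (e := fun θ => I * exp (θ * I)) (by fun_prop)
  have hset : polarCoord.target = Ioi (0 : ℝ) ×ˢ Ioo (-Real.pi) Real.pi := rfl
  rw [hset]
  have hcongr : ∫ p in Ioi (0 : ℝ) ×ˢ Ioo (-Real.pi) Real.pi,
      p.1 • ((z - (z + Complex.polarCoord.symm p))⁻¹ * dbar φ (z + Complex.polarCoord.symm p)) =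
      ∫ p in Ioi (0 : ℝ) ×ˢ Ioo (-Real.pi) Real.pi,
        ((-(1 / 2) : ℂ) * fderiv ℝ φ (z + p.1 * exp (p.2 * I)) (exp (p.2 * I)) +
        (-(1 / 2) * I) * fderiv ℝ φ (z + p.1 * exp (p.2 * I)) (I * exp (p.2 * I))) := by
    refine setIntegral_congr_fun (measurableSet_Ioi.prod measurableSet_Ioo) fun p hp => ?_
    have hp1 : (p.1 : ℂ) ≠ 0 := by exact_mod_cast (show (0 : ℝ) < p.1 from hp.1).ne'
    have hpol : Complex.polarCoord.symm p = p.1 * exp (p.2 * I) := by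
      rw [Complex.polarCoord_symm_apply, exp_mul_I, ofReal_cos, ofReal_sin]
    simp only [hpol]
    set L := fderiv ℝ φ (z + p.1 * exp (p.2 * I)) with hL
    have hlin : ∀ w : ℂ, L w = w.re * L 1 + w.im * L I := fun w => by
      conv_lhs => rw [show w = w.re • (1 : ℂ) + w.im • I by simp]
      rw [map_add, map_smul, map_smul]
      simp
    have he : (exp (p.2 * I))⁻¹ = Real.cos p.2 - Real.sin p.2 * I := by
      rw [← Complex.exp_neg, ← neg_mul, ← ofReal_neg, exp_mul_I, ← ofReal_cos, ← ofReal_sin]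
      simp [sub_eq_add_neg]
    have hre : (exp (p.2 * I)).re = Real.cos p.2 := exp_ofReal_mul_I_re _
    have him : (exp (p.2 * I)).im = Real.sin p.2 := exp_ofReal_mul_I_im _
    rw [hlin (exp _), hlin (I * exp _)]
    simp only [I_mul_re, I_mul_im, hre, him]
    simp only [dbar, ← hL]
    rw [sub_add_cancel_left, inv_neg, mul_inv, he, real_smul]
    field_simp
    push_cast
    linear_combination (sin p.2 * L I) * I_sq
  rw [hcongr]
  have hA' := Integrable.const_mul hA (-(1 / 2) : ℂ)
  have hB' := Integrable.const_mul hB (-(1 / 2) * I : ℂ)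
  rw [integral_add hA' hB', integral_const_mul, integral_const_mul, Measure.volume_eq_prod]
  have e1 : ∫ p in Ioi (0 : ℝ) ×ˢ Ioo (-Real.pi) Real.pi,
      fderiv ℝ φ (z + p.1 * exp (p.2 * I)) (exp (p.2 * I)) ∂(volume.prod volume) =
      2 * Real.pi * -φ z := by
    have hA2 : IntegrableOn (fun q : ℝ × ℝ =>
        fderiv ℝ φ (z + q.2 * exp (q.1 * I)) (exp (q.1 * I)))
        (Ioo (-Real.pi) Real.pi ×ˢ Ioi (0 : ℝ)) (volume.prod volume) := hA.swap
    rw [← setIntegral_prod_swap]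
    simp only [Prod.fst_swap, Prod.snd_swap]
    rw [setIntegral_prod _ hA2]
    simp only [integral_radial_deriv hφ hc, setIntegral_const, measureReal_def, Real.volume_Ioo]
    rw [ENNReal.toReal_ofReal (by linarith [Real.pi_pos]), real_smul]
    push_cast
    ring
  have e2 : ∫ p in Ioi (0 : ℝ) ×ˢ Ioo (-Real.pi) Real.pi,
      fderiv ℝ φ (z + p.1 * exp (p.2 * I)) (I * exp (p.2 * I)) ∂(volume.prod volume) = 0 := by
    rw [setIntegral_prod _ hB]
    refine setIntegral_eq_zero_of_forall_eq_zero fun ρ hρ => ?_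
    exact integral_angular_deriv hφ z hρ
  rw [e1, e2]
  ring

end CauchyPompeiu

/-- The Cauchy kernel, normalised to vanish at `z = a`. -/
noncomputable def cauchyKernel (a z ζ : ℂ) : ℂ := (z - ζ)⁻¹ - (a - ζ)⁻¹

section CauchyKernel

open Set Metric

theorem integrableOn_norm_inv_ball : IntegrableOn (fun x : ℂ => ‖x‖⁻¹) (ball (0 : ℂ) 1) := by
  rw [integrableOn_fun_norm_addHaar volume (f := fun y => y⁻¹)]
  refine (integrableOn_const (C := (1 : ℝ)) (by simp)).congr_fun (fun y hy => ?_) measurableSet_Ioo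
  simp [mul_inv_cancel₀ hy.1.ne']

theorem exists_integral_inv_sub_le (R : ℝ) : ∃ C, ∀ z : ℂ,
    IntegrableOn (fun ζ => (z - ζ)⁻¹) (closedBall 0 R) ∧
      ∫ ζ in closedBall 0 R, ‖(z - ζ)⁻¹‖ ≤ C := by
  set J : ℂ → ℝ := (ball (0 : ℂ) 1).indicator fun x => ‖x‖⁻¹ with hJ
  have hJi : Integrable J := integrableOn_norm_inv_ball.integrable_indicator measurableSet_ball
  have hJ0 : ∀ x, 0 ≤ J x := fun x => indicator_nonneg (fun _ _ => by positivity) x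
  have hle : ∀ x : ℂ, ‖x⁻¹‖ ≤ 1 + J x := fun x => by
    rw [norm_inv]
    by_cases hx : x ∈ ball (0 : ℂ) 1
    · rw [hJ, indicator_of_mem hx]; linarith
    · have h1 : 1 ≤ ‖x‖ := by simpa using hx
      exact (inv_le_one_of_one_le₀ h1).trans (by linarith [hJ0 x])
  have hm : volume (closedBall (0 : ℂ) R) ≠ ⊤ := measure_closedBall_lt_top.ne
  have hbi : ∀ z : ℂ, IntegrableOn (fun ζ => 1 + J (z - ζ)) (closedBall 0 R) := fun z =>
    (integrableOn_const hm).add (hJi.comp_sub_left z).integrableOn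
  refine ⟨(∫ _ in closedBall (0 : ℂ) R, (1 : ℝ)) + ∫ x, J x, fun z => ?_⟩
  have hi : IntegrableOn (fun ζ => (z - ζ)⁻¹) (closedBall 0 R) :=
    (hbi z).mono' (Measurable.aestronglyMeasurable (by fun_prop)) (.of_forall fun ζ => hle _)
  refine ⟨hi, ?_⟩
  calc ∫ ζ in closedBall 0 R, ‖(z - ζ)⁻¹‖
      ≤ ∫ ζ in closedBall (0 : ℂ) R, (1 + J (z - ζ)) :=
        integral_mono hi.norm (hbi z) fun ζ => hle _
    _ = (∫ _ in closedBall (0 : ℂ) R, (1 : ℝ)) + ∫ ζ in closedBall (0 : ℂ) R, J (z - ζ) :=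
        integral_add (integrableOn_const hm) (hJi.comp_sub_left z).integrableOn
    _ ≤ (∫ _ in closedBall (0 : ℂ) R, (1 : ℝ)) + ∫ ζ, J (z - ζ) := by
        refine add_le_add le_rfl ?_
        exact setIntegral_le_integral (hJi.comp_sub_left z) (.of_forall fun ζ => hJ0 _)
    _ = _ := by rw [integral_sub_left_eq_self]

theorem exists_isRotaBaxterKernel_cauchyKernel (a : ℂ) (R : ℝ) : ∃ C, 0 ≤ C ∧
    IsRotaBaxterKernel (volume.restrict (closedBall (0 : ℂ) R)) (cauchyKernel a) C := by
  obtain ⟨C, hC⟩ := exists_integral_inv_sub_le R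
  have hi : ∀ z, Integrable (cauchyKernel a z) (volume.restrict (closedBall (0 : ℂ) R)) :=
    fun z => (hC z).1.sub (hC a).1
  have hne : ∀ x : ℂ, ∀ᵐ ζ ∂(volume.restrict (closedBall (0 : ℂ) R)), ζ ≠ x := fun x =>
    ae_restrict_of_ae (Measure.ae_ne volume x)
  refine ⟨C + C, ?_, ⟨?_, hi, fun z => ?_, fun z => ?_⟩⟩
  · have := (integral_nonneg fun _ => norm_nonneg _).trans (hC 0).2
    linarith
  · unfold cauchyKernel uncurry
    fun_prop
  · calc ∫ ζ in closedBall 0 R, ‖cauchyKernel a z ζ‖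
        ≤ ∫ ζ in closedBall 0 R, (‖(z - ζ)⁻¹‖ + ‖(a - ζ)⁻¹‖) :=
          integral_mono (hi z).norm ((hC z).1.norm.add (hC a).1.norm) fun ζ => norm_sub_le _ _
      _ = _ := integral_add (hC z).1.norm (hC a).1.norm
      _ ≤ _ := add_le_add (hC z).2 (hC a).2
  · filter_upwards [hne z, hne a] with ζ h1 h2
    filter_upwards [hne z, hne a, hne ζ] with ω h3 h4 h5
    have h1 := sub_ne_zero.2 h1.symm
    have h2 := sub_ne_zero.2 h2.symm
    have h3 := sub_ne_zero.2 h3.symm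
    have h4 := sub_ne_zero.2 h4.symm
    have h6 := sub_ne_zero.2 h5
    have h5 := sub_ne_zero.2 h5.symm
    unfold cauchyKernel
    have h7 : (ω - ζ)⁻¹ = -(ζ - ω)⁻¹ := by rw [← neg_sub, inv_neg]
    rw [h7]
    field_simp
    ring

end CauchyKernel

section FiniteExtension

open Set Metric Topology

theorem differentiableOn_kernelOp_cauchyKernel {γ : ℂ → ℂ} (hγ : IsBddMeas γ) (a : ℂ) {r R : ℝ}
    (h0 : ∀ ζ ∈ ball (0 : ℂ) r, γ ζ = 0) :
    DifferentiableOn ℂ (kernelOp (volume.restrict (closedBall (0 : ℂ) R)) (cauchyKernel a) γ)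
      (ball 0 r) := by
  intro z₀ hz₀
  obtain ⟨C, -, hk⟩ := exists_isRotaBaxterKernel_cauchyKernel a R
  obtain ⟨hγm, B, hB⟩ := id hγ
  have hB0 : 0 ≤ B := (norm_nonneg _).trans (hB 0)
  set ε := (r - ‖z₀‖) / 2 with hε
  have hz₀' : ‖z₀‖ < r := by simpa using hz₀
  have hε0 : 0 < ε := by rw [hε]; linarith
  have hfar : ∀ ζ, γ ζ ≠ 0 → ∀ z ∈ ball z₀ ε, ε ≤ ‖z - ζ‖ := by
    intro ζ hζ z hz
    have h1 : r ≤ ‖ζ‖ := by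
      by_contra hlt
      exact hζ (h0 ζ (by simpa using hlt))
    have h2 : ‖z - z₀‖ < ε := by simpa [dist_eq_norm] using hz
    have h3 : ‖ζ‖ ≤ ‖z‖ + ‖z - ζ‖ := by
      simpa using norm_sub_le z (z - ζ)
    have h4 : ‖z‖ ≤ ‖z₀‖ + ‖z - z₀‖ := by simpa using norm_add_le z₀ (z - z₀)
    linarith
  have hmeas : ∀ z, Measurable fun ζ => cauchyKernel a z ζ * γ ζ := fun z => by
    unfold cauchyKernel; fun_prop
  have := hasDerivAt_integral_of_dominated_loc_of_deriv_le
    (μ := volume.restrict (closedBall (0 : ℂ) R)) (F := fun z ζ => cauchyKernel a z ζ * γ ζ)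
    (F' := fun z ζ => -((z - ζ) ^ 2)⁻¹ * γ ζ) (bound := fun _ => (ε ^ 2)⁻¹ * B)
    (ball_mem_nhds z₀ hε0) (.of_forall fun z => (hmeas z).aestronglyMeasurable)
    (hk.integrable_mul hγ z₀) (Measurable.aestronglyMeasurable (by fun_prop))
    (.of_forall fun ζ z hz => ?_) (integrableOn_const measure_closedBall_lt_top.ne)
    (.of_forall fun ζ z hz => ?_)
  · exact this.2.differentiableAt.differentiableWithinAt
  · by_cases hζ : γ ζ = 0
    · simp only [hζ, mul_zero, norm_zero]; positivity
    · have := hfar ζ hζ z hz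
      rw [norm_mul, norm_neg, norm_inv, norm_pow]
      gcongr
      exact hB ζ
  · by_cases hζ : γ ζ = 0
    · simpa [hζ] using hasDerivAt_const z (0 : ℂ)
    · have h1 : z - ζ ≠ 0 := fun h => by
        have := hfar ζ hζ z hz
        rw [h, norm_zero] at this
        linarith
      have h2 := ((((hasDerivAt_id z).sub_const ζ).inv h1).sub_const (a - ζ)⁻¹).mul_const (γ ζ)
      refine h2.congr_deriv ?_
      simp [div_eq_mul_inv]

theorem exists_norm_le_of_eqOn_compl {ψ : ℂ → ℂ} (hψ : Continuous ψ) {b : ℂ} {R : ℝ}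
    (hb : ∀ z ∉ closedBall (0 : ℂ) R, ψ z = b) : ∃ B, ∀ z, ‖ψ z‖ ≤ B := by
  obtain ⟨B, hB⟩ := (isCompact_closedBall (0 : ℂ) R).exists_bound_of_continuousOn hψ.continuousOn
  refine ⟨max B ‖b‖, fun z => ?_⟩
  by_cases hz : z ∈ closedBall (0 : ℂ) R
  · exact (hB z hz).trans (le_max_left _ _)
  · rw [hb z hz]; exact le_max_right _ _

theorem dbar_eq_zero_of_eqOn_compl {φ : ℂ → ℂ} {b : ℂ} {R : ℝ}
    (hb : ∀ z ∉ closedBall (0 : ℂ) R, φ z = b) {z : ℂ} (hz : z ∉ closedBall (0 : ℂ) R) :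
    dbar φ z = 0 := by
  refine dbar_eq_zero ?_
  have : φ =ᶠ[𝓝 z] fun _ => b := by
    filter_upwards [isClosed_closedBall.isOpen_compl.mem_nhds hz] with x hx using hb x hx
  exact (differentiableAt_const b).congr_of_eventuallyEq this

theorem sub_eq_kernelOp_dbar {φ : ℂ → ℂ} (hφ : ContDiff ℝ 1 φ) {b : ℂ} {R : ℝ}
    (hb : ∀ z ∉ closedBall (0 : ℂ) R, φ z = b) (a z : ℂ) :
    φ z - φ a = kernelOp (volume.restrict (closedBall (0 : ℂ) R)) (cauchyKernel a)
      (fun ζ => dbar φ ζ / Real.pi) z := by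
  have hc : HasCompactSupport fun z => φ z - b :=
    HasCompactSupport.intro (isCompact_closedBall (0 : ℂ) R) fun z hz => by simp [hb z hz]
  have hd : dbar (fun z => φ z - b) = dbar φ := by
    ext x
    simp [dbar, fderiv_sub_const]
  obtain ⟨B, hB⟩ := exists_norm_le_of_eqOn_compl (continuous_dbar hφ)
    fun z hz => dbar_eq_zero_of_eqOn_compl hb hz
  obtain ⟨C, hC⟩ := exists_integral_inv_sub_le R
  have hi : ∀ x, IntegrableOn (fun ζ => (x - ζ)⁻¹ * dbar φ ζ) (closedBall 0 R) := fun x =>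
    (hC x).1.mul_bdd (continuous_dbar hφ).aestronglyMeasurable (.of_forall hB)
  have hP : ∀ x, ∫ ζ in closedBall 0 R, (x - ζ)⁻¹ * dbar φ ζ = Real.pi * (φ x - b) := fun x => by
    rw [setIntegral_eq_integral_of_forall_compl_eq_zero fun ζ hζ => by
      rw [dbar_eq_zero_of_eqOn_compl hb hζ, mul_zero], ← hd]
    exact integral_inv_sub_mul_dbar (hφ.sub contDiff_const) hc x
  have hπ : (Real.pi : ℂ) ≠ 0 := by exact_mod_cast Real.pi_ne_zero
  have h1 : kernelOp (volume.restrict (closedBall (0 : ℂ) R)) (cauchyKernel a)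
      (fun ζ => dbar φ ζ / Real.pi) z = (∫ ζ in closedBall 0 R,
        ((z - ζ)⁻¹ * dbar φ ζ - (a - ζ)⁻¹ * dbar φ ζ)) / Real.pi := by
    rw [kernelOp, ← integral_div]
    congr 1
    ext ζ
    rw [cauchyKernel]
    ring
  rw [h1, integral_sub (hi z) (hi a), hP, hP]
  field_simp
  ring

/-- The right-hand side of the equation for `dbar`: it interpolates the values `β i` prescribed at the
points `φ i ζ`, by tent functions of radius `δ`. -/
noncomputable def tentInterp {ι : Type*} [Fintype ι] (δ : ℝ) (φ β : ι → ℂ → ℂ) (ζ v : ℂ) : ℂ :=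
  ∑ i, ((max (1 - ‖v - φ i ζ‖ / δ) 0 : ℝ) : ℂ) * β i ζ

section tentInterp

variable {ι : Type*} [Fintype ι] {δ : ℝ} {φ β : ι → ℂ → ℂ}

theorem measurable_tentInterp (hφ : ∀ i, Measurable (φ i)) (hβ : ∀ i, Measurable (β i)) :
    Measurable (uncurry (tentInterp δ φ β)) := by
  unfold tentInterp uncurry
  refine Finset.measurable_sum _ fun i _ => ?_
  have h1 : Measurable fun p : ℂ × ℂ => φ i p.1 := (hφ i).comp measurable_fst
  have h2 : Measurable fun p : ℂ × ℂ => β i p.1 := (hβ i).comp measurable_fst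
  fun_prop

theorem norm_tentInterp_le (hδ : 0 < δ) {B : ι → ℝ} (hB : ∀ i z, ‖β i z‖ ≤ B i) (ζ v : ℂ) :
    ‖tentInterp δ φ β ζ v‖ ≤ ∑ i, B i := by
  refine norm_sum_le_of_le _ fun i _ => ?_
  rw [norm_mul, Complex.norm_real, Real.norm_of_nonneg (le_max_right _ _)]
  have h1 : max (1 - ‖v - φ i ζ‖ / δ) 0 ≤ 1 :=
    max_le (by have : 0 ≤ ‖v - φ i ζ‖ / δ := by positivity
               linarith) zero_le_one
  calc _ ≤ 1 * ‖β i ζ‖ := mul_le_mul_of_nonneg_right h1 (norm_nonneg _)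
    _ ≤ B i := by rw [one_mul]; exact hB i ζ

theorem norm_tentInterp_sub_le (hδ : 0 < δ) {B : ι → ℝ} (hB : ∀ i z, ‖β i z‖ ≤ B i)
    (ζ v w : ℂ) :
    ‖tentInterp δ φ β ζ v - tentInterp δ φ β ζ w‖ ≤ (∑ i, B i / δ) * ‖v - w‖ := by
  rw [tentInterp, tentInterp, ← Finset.sum_sub_distrib, Finset.sum_mul]
  refine norm_sum_le_of_le _ fun i _ => ?_
  rw [← sub_mul, norm_mul, ← Complex.ofReal_sub, Complex.norm_real, Real.norm_eq_abs]
  have h1 : |max (1 - ‖v - φ i ζ‖ / δ) 0 - max (1 - ‖w - φ i ζ‖ / δ) 0| ≤ ‖v - w‖ / δ := by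
    refine (abs_max_sub_max_le_abs _ _ _).trans ?_
    rw [sub_sub_sub_cancel_left, ← sub_div, abs_div, abs_of_pos hδ]
    gcongr
    rw [norm_sub_rev v w]
    simpa using abs_norm_sub_norm_le (w - φ i ζ) (v - φ i ζ)
  calc _ ≤ ‖v - w‖ / δ * B i := mul_le_mul h1 (hB i ζ) (norm_nonneg _) (by positivity)
    _ = _ := by ring

theorem tentInterp_apply (hδ : 0 < δ) (hsep : ∀ i j, i ≠ j → ∀ z, δ ≤ ‖φ i z - φ j z‖)
    (i : ι) (ζ : ℂ) : tentInterp δ φ β ζ (φ i ζ) = β i ζ := by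
  classical
  rw [tentInterp, Finset.sum_eq_single i]
  · simp
  · intro j _ hj
    have := (one_le_div hδ).2 (hsep i j hj.symm ζ)
    rw [max_eq_right (by linarith)]
    simp
  · simp

theorem tentInterp_eq_zero {ζ : ℂ} (h : ∀ i, β i ζ = 0) (v : ℂ) : tentInterp δ φ β ζ v = 0 :=
  Finset.sum_eq_zero fun i _ => by rw [h i, mul_zero]

end tentInterp


theorem isBddMeas_of_uncurry {X : Type*} [MeasurableSpace X] {F : X → ℂ → ℂ}
    (hF : Measurable (uncurry F)) {B : ℝ} (hB : ∀ x w, ‖F x w‖ ≤ B) {g : X → ℂ}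
    (hg : Measurable g) : IsBddMeas fun x => F x (g x) :=
  ⟨hF.comp (measurable_id.prodMk hg), B, fun x => hB x (g x)⟩

theorem exists_avoiding_of_separated {ι : Type*} [Fintype ι] {φ : ι → ℂ → ℂ} {b : ι → ℂ}
    {r R δ : ℝ} (hφ : ∀ i, ContDiff ℝ 1 (φ i))
    (hb : ∀ i, ∀ z ∉ closedBall (0 : ℂ) R, φ i z = b i) (hδ : 0 < δ)
    (hsep : ∀ i j, i ≠ j → ∀ z, δ ≤ ‖φ i z - φ j z‖)
    (hol : ∀ i, DifferentiableOn ℂ (φ i) (ball 0 r)) (a : ℂ) {w : ℂ}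
    (hw : ∀ i, w ≠ φ i a) :
    ∃ g : ℂ → ℂ, DifferentiableOn ℂ g (ball 0 r) ∧ g a = w ∧ ∀ i z, g z ≠ φ i z := by
  obtain ⟨C, hC, hk⟩ := exists_isRotaBaxterKernel_cauchyKernel a R
  set β : ι → ℂ → ℂ := fun i ζ => dbar (φ i) ζ / Real.pi with hβ
  have hβc : ∀ i, Continuous (β i) := fun i => (continuous_dbar (hφ i)).div_const _
  have hβb : ∀ i, ∃ B, ∀ z, ‖β i z‖ ≤ B := fun i =>
    exists_norm_le_of_eqOn_compl (hβc i) (b := 0) (R := R) fun z hz => by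
      simp [hβ, dbar_eq_zero_of_eqOn_compl (hb i) hz]
  choose B hB using hβb
  have hB0 : ∀ i, 0 ≤ B i := fun i => (norm_nonneg _).trans (hB i 0)
  have hFm : Measurable (uncurry (tentInterp δ φ β)) :=
    measurable_tentInterp (fun i => (hφ i).continuous.measurable) fun i => (hβc i).measurable
  have hK : 0 ≤ ∑ i, B i / δ := Finset.sum_nonneg fun i _ => div_nonneg (hB0 i) hδ.le
  have hlip := norm_tentInterp_sub_le (φ := φ) hδ hB
  obtain ⟨g, hg, hgeq⟩ := hk.exists_solution hC hFm (norm_tentInterp_le hδ hB) hK hlip w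
  have hγ : IsBddMeas fun x => tentInterp δ φ β x (g x) :=
    isBddMeas_of_uncurry hFm (norm_tentInterp_le hδ hB) hg.1
  refine ⟨g, ?_, ?_, fun i z => ?_⟩
  · have h1 := differentiableOn_kernelOp_cauchyKernel hγ a (r := r) (R := R) fun ζ hζ =>
      tentInterp_eq_zero (fun i => by
        rw [hβ]
        simp [dbar_eq_zero ((hol i).differentiableAt (isOpen_ball.mem_nhds hζ))]) _
    exact (h1.const_add w).congr fun z _ => hgeq z
  · rw [hgeq a]
    simp [kernelOp, cauchyKernel]
  · have hφi : IsBddMeas (φ i) := ⟨(hφ i).continuous.measurable,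
      exists_norm_le_of_eqOn_compl (hφ i).continuous (hb i)⟩
    obtain ⟨α, hα, -, hαeq⟩ := IsRotaBaxterKernel.exists_quotient hFm hK hlip hg.1 hφi.1
    have hβi : IsBddMeas (β i) := ⟨(hβc i).measurable, B i, hB i⟩
    have heq : ∀ x, g x - φ i x = w - φ i a + kernelOp (volume.restrict (closedBall (0 : ℂ) R))
        (cauchyKernel a) (fun y => α y * (g y - φ i y)) x := fun x => by
      simp only [← hαeq, tentInterp_apply hδ hsep]
      rw [hk.map_sub hγ hβi, hgeq x]
      linear_combination -sub_eq_kernelOp_dbar (hφ i) (hb i) a x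
    have hu := hk.eq_mul_exp hα (hg.sub hφi) heq z
    refine sub_ne_zero.1 ?_
    rw [hu]
    exact mul_ne_zero (sub_ne_zero.2 (hw i)) (Complex.exp_ne_zero _)

theorem exists_separation {ι : Type*} [Finite ι] {f : ι → ℂ → ℂ} {K : Set ℂ} (hK : IsCompact K)
    (hf : ∀ i, ContinuousOn (f i) K) (hd : ∀ i j, i ≠ j → ∀ c ∈ K, f i c ≠ f j c) :
    ∃ δ > 0, ∀ i j, i ≠ j → ∀ c ∈ K, δ ≤ ‖f i c - f j c‖ := by
  have h : ∀ᶠ δ in 𝓝[>] (0 : ℝ), ∀ i j, i ≠ j → ∀ c ∈ K, δ ≤ ‖f i c - f j c‖ := by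
    simp only [Filter.eventually_all]
    intro i j hij
    obtain ⟨δ, hδ, h⟩ := hK.exists_forall_le' (a := 0) ((hf i).sub (hf j)).norm
      fun c hc => norm_pos_iff.2 (sub_ne_zero.2 (hd i j hij c hc))
    filter_upwards [Ioo_mem_nhdsGT hδ] with x hx c hc using hx.2.le.trans (h c hc)
  obtain ⟨δ, h, hδ⟩ := (h.and self_mem_nhdsWithin).exists
  exact ⟨δ, hδ, h⟩

/-- A smooth map of the plane into the unit disk, which is the identity on `ball 0 r` and
constant far away. -/
theorem exists_contDiff_retraction {r : ℝ} (hr0 : 0 < r) (hr : r < 1) :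
    ∃ ψ : ℂ → ℂ, ∃ R < 1, ContDiff ℝ 1 ψ ∧ (∀ z, ψ z ∈ closedBall (0 : ℂ) R) ∧
      (∀ z ∈ ball (0 : ℂ) r, ψ z = z) ∧ ∀ z ∉ closedBall (0 : ℂ) R, ψ z = 0 := by
  have hR : r < (1 + r) / 2 := by linarith
  let χ : ContDiffBump (0 : ℂ) := ⟨r, (1 + r) / 2, hr0, hR⟩
  refine ⟨fun z => χ z • z, (1 + r) / 2, by linarith, χ.contDiff.smul contDiff_id, fun z => ?_,
    fun z hz => ?_, fun z hz => ?_⟩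
  · beta_reduce
    by_cases hz : z ∈ closedBall (0 : ℂ) ((1 + r) / 2)
    · rw [mem_closedBall_zero_iff] at hz ⊢
      rw [norm_smul, Real.norm_of_nonneg χ.nonneg]
      exact (mul_le_of_le_one_left (norm_nonneg _) χ.le_one).trans hz
    · rw [χ.zero_of_le_dist (not_le.1 hz).le]
      simp only [zero_smul, mem_closedBall, dist_self]
      linarith
  · simp only [χ.one_of_mem_closedBall (ball_subset_closedBall hz), one_smul]
  · simp only [χ.zero_of_le_dist (not_le.1 hz).le, zero_smul]

theorem exists_avoiding_of_finite {ι : Type*} [Finite ι] {f : ι → ℂ → ℂ}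
    (hf : ∀ i, DifferentiableOn ℂ (f i) (ball 0 1))
    (hd : ∀ i j, i ≠ j → ∀ c ∈ ball (0 : ℂ) 1, f i c ≠ f j c) {r : ℝ} (hr : r < 1) {a w : ℂ}
    (ha : a ∈ ball (0 : ℂ) r) (hw : ∀ i, w ≠ f i a) :
    ∃ g : ℂ → ℂ, DifferentiableOn ℂ g (ball 0 r) ∧ g a = w ∧
      ∀ i, ∀ c ∈ ball (0 : ℂ) r, g c ≠ f i c := by
  have := Fintype.ofFinite ι
  obtain ⟨ψ, R, hR, hψ, hψR, hψid, hψ0⟩ := exists_contDiff_retraction (pos_of_mem_ball ha) hr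
  have hsub : closedBall (0 : ℂ) R ⊆ ball 0 1 := closedBall_subset_ball hR
  obtain ⟨δ, hδ, hsep⟩ := exists_separation (isCompact_closedBall (0 : ℂ) R)
    (fun i => (hf i).continuousOn.mono hsub) fun i j hij c hc => hd i j hij c (hsub hc)
  have hc : ∀ i, ContDiff ℝ 1 fun z => f i (ψ z) := fun i =>
    (((hf i).contDiffOn (n := 1) isOpen_ball).restrict_scalars ℝ).comp_contDiff hψ
      fun z => hsub (hψR z)
  obtain ⟨g, hg, hga, hgne⟩ := exists_avoiding_of_separated (φ := fun i z => f i (ψ z))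
    (b := fun i => f i 0) (r := r) (R := R) hc (fun i z hz => by simp only [hψ0 z hz]) hδ
    (fun i j hij z => hsep i j hij _ (hψR z))
    (fun i => ((hf i).mono (ball_subset_ball hr.le)).congr fun z hz => by simp only [hψid z hz])
    a (w := w) fun i => by simpa only [hψid a ha] using hw i
  exact ⟨g, hg, hga, fun i c hc => by simpa only [hψid c hc] using hgne i c⟩

end FiniteExtension

end FiniteFamilies

section Schottky

open Set Metric Topology Complex

variable {r : ℝ}

theorem exists_eqOn_exp {F : ℂ → ℂ} (hF : DifferentiableOn ℂ F (ball 0 r))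
    (h0 : ∀ z ∈ ball (0 : ℂ) r, F z ≠ 0) :
    ∃ L : ℂ → ℂ, DifferentiableOn ℂ L (ball 0 r) ∧ ∀ z ∈ ball (0 : ℂ) r, F z = exp (L z) := by
  rcases le_or_gt r 0 with hr | hr
  · rw [ball_eq_empty.2 hr]
    exact ⟨fun _ => 0, by simp, by simp⟩
  have hq : DifferentiableOn ℂ (fun z => deriv F z / F z) (ball 0 r) :=
    (hF.deriv isOpen_ball).div hF h0
  obtain ⟨L, hL0, hL⟩ := hq.isExactOn_ball.with_val_at 0 (log (F 0))
  have hd : ∀ z ∈ ball (0 : ℂ) r, HasDerivAt (fun z => F z * exp (-L z)) 0 z := fun z hz => by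
    have h1 := (hF.differentiableAt (isOpen_ball.mem_nhds hz)).hasDerivAt
    refine (h1.mul (hL z hz).neg.cexp).congr_deriv ?_
    have := h0 z hz
    field_simp
    ring
  have hz0 : (0 : ℂ) ∈ ball (0 : ℂ) r := mem_ball_self hr
  refine ⟨L, fun z hz => (hL z hz).differentiableAt.differentiableWithinAt, fun z hz => ?_⟩
  have hc := isOpen_ball.is_const_of_deriv_eq_zero (convex_ball (0 : ℂ) r).isPreconnected
    (fun z hz => (hd z hz).differentiableAt.differentiableWithinAt)
    (fun z hz => (hd z hz).deriv) hz hz0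
  simp only [hL0] at hc
  rw [exp_neg, exp_neg, exp_log (h0 0 hz0), mul_inv_cancel₀ (h0 0 hz0)] at hc
  exact (mul_inv_eq_one₀ (exp_ne_zero _)).1 hc

theorem abs_sinh_im_le_norm_cos (z : ℂ) : |Real.sinh z.im| ≤ ‖cos z‖ := by
  have h1 : cos z = (exp (z * I) - -exp (-z * I)) / 2 := by rw [cos]; ring
  have h2 := abs_norm_sub_norm_le (exp (z * I)) (-exp (-z * I))
  rw [norm_neg, norm_exp, norm_exp] at h2
  have h3 : (z * I).re = -z.im := by simp
  have h4 : (-z * I).re = z.im := by simp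
  rw [h3, h4] at h2
  rw [h1, norm_div, Real.sinh_eq, abs_div, norm_ofNat, abs_two, abs_sub_comm]
  gcongr

theorem exists_eqOn_cos {F : ℂ → ℂ} (hF : DifferentiableOn ℂ F (ball 0 r))
    (h1 : ∀ z ∈ ball (0 : ℂ) r, F z ≠ 1) (h2 : ∀ z ∈ ball (0 : ℂ) r, F z ≠ -1) (hr : 0 < r) :
    ∃ G : ℂ → ℂ, DifferentiableOn ℂ G (ball 0 r) ∧
      (∀ z ∈ ball (0 : ℂ) r, F z = cos (Real.pi * G z)) ∧ ‖G 0‖ ≤ 1 + ‖F 0‖ := by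
  have hπ : (Real.pi : ℂ) ≠ 0 := by exact_mod_cast Real.pi_ne_zero
  obtain ⟨L, hL, hLe⟩ := exists_eqOn_exp (F := fun z => 1 - F z ^ 2) ((hF.pow 2).const_sub 1)
    fun z hz h => by
      have : (1 - F z) * (1 + F z) = 0 := by rw [← h]; ring
      rcases mul_eq_zero.1 this with h | h
      · exact h1 z hz (sub_eq_zero.1 h).symm
      · exact h2 z hz (eq_neg_of_add_eq_zero_right h)
  have hprod : ∀ z ∈ ball (0 : ℂ) r,
      (F z + I * exp (L z / 2)) * (F z - I * exp (L z / 2)) = 1 := fun z hz => by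
    have h3 : exp (L z / 2) ^ 2 = 1 - F z ^ 2 := by
      rw [← exp_nat_mul, hLe z hz]; congr 1; push_cast; ring
    linear_combination h3 - exp (L z / 2) ^ 2 * I_sq
  obtain ⟨P, hP, hPe⟩ := exists_eqOn_exp (F := fun z => F z + I * exp (L z / 2))
    (hF.add (((hL.div_const 2).cexp).const_mul I))
    fun z hz => left_ne_zero_of_mul_eq_one (hprod z hz)
  set G₀ : ℂ → ℂ := fun z => P z / (Real.pi * I) with hG₀
  have hcos : ∀ z ∈ ball (0 : ℂ) r, cos (Real.pi * G₀ z) = F z := fun z hz => by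
    have e1 : Real.pi * G₀ z * I = P z := by
      rw [hG₀]; field_simp
    have e2 : exp (-P z) = F z - I * exp (L z / 2) := by
      rw [exp_neg, ← hPe z hz]
      exact inv_eq_of_mul_eq_one_right (hprod z hz)
    rw [cos, neg_mul, e1, e2, ← hPe z hz]
    ring
  set k : ℤ := round ((G₀ 0).re / 2) with hk
  have hz0 : (0 : ℂ) ∈ ball (0 : ℂ) r := mem_ball_self hr
  have hcos' : ∀ z ∈ ball (0 : ℂ) r, F z = cos (Real.pi * (G₀ z - 2 * k)) := fun z hz => by
    rw [← hcos z hz, ← cos_sub_int_mul_two_pi _ k]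
    congr 1
    ring
  refine ⟨fun z => G₀ z - 2 * k, (hP.div_const _).sub_const _, hcos', ?_⟩
  refine (norm_le_abs_re_add_abs_im _).trans (add_le_add ?_ ?_)
  · have := abs_sub_round ((G₀ 0).re / 2)
    rw [← hk] at this
    have e : (G₀ 0 - 2 * k).re = 2 * ((G₀ 0).re / 2 - k) := by
      simp
      ring
    rw [e, abs_mul, abs_two]
    linarith
  · have h3 := abs_sinh_im_le_norm_cos (Real.pi * (G₀ 0 - 2 * k))
    rw [← hcos' 0 hz0, im_ofReal_mul] at h3
    refine le_trans ?_ h3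
    rw [Real.abs_sinh, abs_mul, abs_of_pos Real.pi_pos]
    refine le_trans ?_ (Real.self_le_sinh_iff.2 (by positivity))
    exact le_mul_of_one_le_left (abs_nonneg _) (by linarith [Real.pi_gt_three])

/-- Every disk of radius one contains a point whose image under `cos (π ·)` is an integer. -/
theorem exists_cos_eq_int (w : ℂ) : ∃ p ∈ ball w 1, ∃ n : ℤ, cos (Real.pi * p) = n := by
  set m : ℤ := round w.re
  set n : ℤ := ⌊Real.cosh (Real.pi * w.im)⌋ with hn
  have hn1 : 1 ≤ n := Int.le_floor.2 (by exact_mod_cast Real.one_le_cosh _)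
  have hn1' : (1 : ℝ) ≤ n := by exact_mod_cast hn1
  set t := Real.arcosh n with ht
  have ht0 : 0 ≤ t := Real.arcosh_nonneg hn1'
  have hct : Real.cosh t = n := Real.cosh_arcosh hn1'
  have h1 : t ≤ Real.pi * |w.im| := by
    have : Real.cosh t ≤ Real.cosh (Real.pi * w.im) := by rw [hct]; exact Int.floor_le _
    rw [Real.cosh_le_cosh, abs_of_nonneg ht0, abs_mul, abs_of_pos Real.pi_pos] at this
    exact this
  have h2 : Real.pi * |w.im| < t + Real.pi / 2 := by
    have h3 : Real.cosh (Real.pi * w.im) < n + 1 := Int.lt_floor_add_one _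
    have h4 : 2 ≤ Real.cosh (Real.pi / 2) := by
      have e1 : Real.exp (3 / 2) ≤ Real.exp (Real.pi / 2) :=
        Real.exp_le_exp.2 (by linarith [Real.pi_gt_three])
      have e2 : Real.exp (3 / 2) = Real.exp 1 * Real.exp (1 / 2) := by
        rw [← Real.exp_add]; norm_num
      have e3 := Real.add_one_le_exp (1 / 2)
      have e4 := Real.exp_one_gt_d9
      rw [Real.cosh_eq]
      nlinarith [Real.exp_pos (-(Real.pi / 2))]
    have h5 : Real.cosh (Real.pi * w.im) < Real.cosh (t + Real.pi / 2) := by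
      rw [Real.cosh_add, hct]
      have := mul_nonneg (Real.sinh_nonneg_iff.2 ht0)
        (Real.sinh_nonneg_iff.2 (by positivity : 0 ≤ Real.pi / 2))
      nlinarith
    rw [Real.cosh_lt_cosh, abs_mul, abs_of_pos Real.pi_pos,
      abs_of_nonneg (a := t + Real.pi / 2) (by positivity)] at h5
    exact h5
  obtain ⟨s, hs, hsw⟩ : ∃ s : ℝ, Real.cosh (Real.pi * s) = n ∧ |w.im - s| < 1 / 2 := by
    have e : |(|w.im| - t / Real.pi)| < 1 / 2 := by
      rw [abs_lt]
      have := Real.pi_pos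
      constructor
      · rw [lt_sub_iff_add_lt]
        have : t / Real.pi ≤ |w.im| := by rw [div_le_iff₀ Real.pi_pos]; linarith
        linarith
      · rw [sub_lt_iff_lt_add, ← mul_lt_mul_iff_right₀ Real.pi_pos]
        field_simp
        linarith
    rcases abs_cases w.im with ⟨h, -⟩ | ⟨h, -⟩
    · exact ⟨t / Real.pi, by rw [mul_div_cancel₀ _ Real.pi_ne_zero, hct], by rwa [h] at e⟩
    · refine ⟨-(t / Real.pi), by rw [mul_neg, Real.cosh_neg, mul_div_cancel₀ _ Real.pi_ne_zero, hct], ?_⟩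
      rw [← abs_neg]
      rw [h] at e
      convert e using 2
      ring
  refine ⟨m + s * I, ?_, ?_⟩
  · rw [mem_ball, dist_comm, dist_eq]
    refine (norm_le_abs_re_add_abs_im _).trans_lt ?_
    have := abs_sub_round w.re
    simp only [sub_re, add_re, intCast_re, mul_re, ofReal_re, I_re, mul_zero, ofReal_im, I_im,
      sub_im, add_im, intCast_im, mul_im, mul_one, sub_zero, add_zero, zero_add]
    linarith
  · have h3 : cos (Real.pi * (m + s * I)) = (cos (m * Real.pi)) * n := by
      rw [mul_add, ← mul_assoc, cos_add_mul_I, ← ofReal_mul, ← ofReal_cosh, hs,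
        mul_comm (Real.pi : ℂ) m, sin_int_mul_pi]
      simp
    rcases Int.even_or_odd m with hm | hm
    · obtain ⟨k, hk⟩ := hm
      refine ⟨n, ?_⟩
      have : cos (m * Real.pi) = 1 := by
        rw [← cos_int_mul_two_pi k, hk]
        congr 1
        push_cast
        ring
      rw [h3, this, one_mul]
    · obtain ⟨k, hk⟩ := hm
      refine ⟨-n, ?_⟩
      have : cos (m * Real.pi) = -1 := by
        rw [← cos_int_mul_two_pi_add_pi k, hk]
        congr 1
        push_cast
        ring
      rw [h3, this]
      push_cast
      ring

/-- A weak form of Bloch's theorem. -/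
theorem norm_deriv_mul_le_of_omits {r : ℝ} {g : ℂ → ℂ} (hg : DifferentiableOn ℂ g (ball 0 r))
    (hom : ∀ w, ∃ p ∈ ball w 1, ∀ z ∈ ball (0 : ℂ) r, g z ≠ p) {a : ℂ} {s : ℝ} (hs : 0 < s)
    (hsub : closedBall a s ⊆ ball 0 r) : ‖deriv g a‖ * s ≤ 48 := by
  have hd : DifferentiableOn ℂ (deriv g) (ball 0 r) := hg.deriv isOpen_ball
  have hcont : ContinuousOn (fun z => (s - dist z a) * ‖deriv g z‖) (closedBall a s) :=
    ContinuousOn.mul (by fun_prop) (hd.continuousOn.mono hsub).norm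
  obtain ⟨p, hp, hmax⟩ := (isCompact_closedBall a s).exists_isMaxOn
    ⟨a, mem_closedBall_self hs.le⟩ hcont
  have hmax : ∀ z ∈ closedBall a s, (s - dist z a) * ‖deriv g z‖ ≤ (s - dist p a) * ‖deriv g p‖ :=
    fun z hz => hmax hz
  have ha := hmax a (mem_closedBall_self hs.le)
  rw [dist_self, sub_zero] at ha
  by_contra! hlt
  set D := ‖deriv g p‖ with hD
  have hM : 48 < (s - dist p a) * D := by linarith
  set t := (s - dist p a) / 2 with ht
  have hpa : dist p a ≤ s := hp
  have ht0 : 0 < t := by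
    by_contra hle
    have : s - dist p a = 0 := by linarith
    rw [this, zero_mul] at hM
    linarith
  have hD0 : 0 < D := by
    by_contra hle
    have : D = 0 := le_antisymm (not_lt.1 hle) (norm_nonneg _)
    rw [this, mul_zero] at hM
    linarith
  have htsub : ball p t ⊆ closedBall a s := fun z hz => by
    have h1 : dist z p < t := hz
    have := dist_triangle z p a
    rw [mem_closedBall]
    linarith
  have hbd : ∀ z ∈ ball p t, ‖deriv g z‖ ≤ 2 * D := fun z hz => by
    have h1 : dist z p < t := hz
    have h2 := hmax z (htsub hz)
    have h3 := dist_triangle z p a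
    have h4 : t * ‖deriv g z‖ ≤ t * (2 * D) := by
      calc t * ‖deriv g z‖ ≤ (s - dist z a) * ‖deriv g z‖ :=
            mul_le_mul_of_nonneg_right (by linarith) (norm_nonneg _)
        _ ≤ (s - dist p a) * D := h2
        _ = t * (2 * D) := by rw [ht]; ring
    exact le_of_mul_le_mul_left h4 ht0
  have hsch : ∀ z ∈ ball p t, ‖deriv g z - deriv g p‖ ≤ 3 * D / t * dist z p := fun z hz => by
    rw [← dist_eq_norm]
    refine dist_le_div_mul_dist_of_mapsTo_ball (hd.mono (htsub.trans hsub)) (fun y hy => ?_) hz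
    rw [mem_closedBall, dist_eq_norm]
    refine (norm_sub_le _ _).trans ?_
    linarith [hbd y hy]
  have h6 : closedBall p (t / 6) ⊆ ball p t := closedBall_subset_ball (by linarith)
  have hdiff : ∀ z ∈ closedBall p (t / 6), HasDerivAt g (deriv g z) z := fun z hz =>
    (hg.differentiableAt (isOpen_ball.mem_nhds (hsub (htsub (h6 hz))))).hasDerivAt
  have hlow : ∀ z ∈ sphere p (t / 6), D * t / 12 ≤ ‖g z - g p‖ := fun z hz => by
    have hz' := sphere_subset_closedBall hz
    have h7 := (convex_closedBall p (t / 6)).norm_image_sub_le_of_norm_hasDerivWithin_le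
      (f := fun y => g y - deriv g p * y) (f' := fun y => deriv g y - deriv g p) (C := D / 2)
      (fun y hy => by
        exact (((hdiff y hy).sub ((hasDerivAt_id y).const_mul (deriv g p))).congr_deriv
          (by rw [mul_one])).hasDerivWithinAt)
      (fun y hy => (hsch y (h6 hy)).trans (by
        have hy : dist y p ≤ t / 6 := hy
        calc 3 * D / t * dist y p ≤ 3 * D / t * (t / 6) := by gcongr
          _ = D / 2 := by field_simp; norm_num))
      (mem_closedBall_self (by positivity)) hz'
    have h8 : ‖z - p‖ = t / 6 := by rw [← dist_eq_norm]; exact hz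
    rw [h8] at h7
    have h9 : ‖deriv g p * (z - p)‖ = D * (t / 6) := by rw [norm_mul, h8]
    have h10 : ‖deriv g p * (z - p)‖ ≤ ‖g z - g p‖ +
        ‖g z - deriv g p * z - (g p - deriv g p * p)‖ := by
      refine le_trans (le_of_eq ?_) (norm_sub_le _ _)
      congr 1
      ring
    rw [h9] at h10
    linarith
  have hball := DiffContOnCl.ball_subset_image_closedBall (f := g) (z₀ := p) (r := t / 6)
    ⟨fun z hz => (hdiff z (ball_subset_closedBall hz)).differentiableAt.differentiableWithinAt,
      fun z hz => (hdiff z (closure_ball_subset_closedBall hz)).continuousAt.continuousWithinAt⟩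
    (by positivity) hlow (by
      have h1 := (hdiff p (mem_closedBall_self (by positivity))).eventually_ne
        (c := g p) (norm_pos_iff.1 hD0)
      exact h1.frequently.filter_mono nhdsWithin_le_nhds)
  obtain ⟨q, hq, hqo⟩ := hom (g p)
  have hq1 : dist q (g p) < 1 := hq
  obtain ⟨z, hz, rfl⟩ := hball (show q ∈ ball (g p) (D * t / 12 / 2) by
    rw [mem_ball]
    have : (s - dist p a) * D = D * t * 2 := by rw [ht]; ring
    linarith)
  exact hqo z (hsub (htsub (h6 hz))) rfl

theorem norm_cos_le_exp_norm (z : ℂ) : ‖cos z‖ ≤ Real.exp ‖z‖ := by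
  have h1 := norm_exp_le_exp_norm (z * I)
  have h2 := norm_exp_le_exp_norm (-z * I)
  have h3 := norm_add_le (exp (z * I)) (exp (-z * I))
  simp only [norm_mul, norm_I, mul_one, norm_neg] at h1 h2
  rw [cos, norm_div, norm_ofNat]
  linarith

/-- A holomorphic self-map of the unit disk interchanging `0` and `c`. -/
theorem exists_swap_zero {c : ℂ} (hc : c ∈ ball (0 : ℂ) 1) : ∃ T : ℂ → ℂ,
    DifferentiableOn ℂ T (ball 0 1) ∧ MapsTo T (ball 0 1) (ball 0 1) ∧ T 0 = c ∧ T c = 0 := by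
  have hne : ∀ z ∈ ball (0 : ℂ) 1, 1 - (starRingEnd ℂ) c * z ≠ 0 := fun z hz h => by
    rw [mem_ball_zero_iff] at hc hz
    have h1 : ‖(starRingEnd ℂ) c * z‖ = 1 := by
      rw [← sub_eq_zero.1 h, norm_one]
    rw [norm_mul, RCLike.norm_conj] at h1
    have := mul_lt_one_of_nonneg_of_lt_one_left (norm_nonneg c) hc hz.le
    linarith
  refine ⟨fun z => (c - z) / (1 - (starRingEnd ℂ) c * z), fun z hz => ?_, fun z hz => ?_,
    by simp, by simp⟩
  · exact (((differentiableAt_id.const_sub c).div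
      ((differentiableAt_id.const_mul _).const_sub 1)) (hne z hz)).differentiableWithinAt
  · rw [mem_ball_zero_iff, norm_div, div_lt_one (norm_pos_iff.2 (hne z hz)),
      ← sq_lt_sq₀ (norm_nonneg _) (norm_nonneg _)]
    rw [mem_ball_zero_iff, ← sq_lt_one_iff₀ (norm_nonneg _)] at hc hz
    rw [Complex.sq_norm, normSq_apply] at hc hz ⊢
    rw [Complex.sq_norm, normSq_apply]
    simp only [sub_re, sub_im, mul_re, mul_im, conj_re, conj_im, one_re, one_im]
    nlinarith [mul_pos (sub_pos.2 hc) (sub_pos.2 hz)]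

/-- Holomorphic functions on the unit disk omitting the values `0` and `1`. -/
def OmitsZeroOne (φ : ℂ → ℂ) : Prop :=
  DifferentiableOn ℂ φ (ball 0 1) ∧ ∀ z ∈ ball (0 : ℂ) 1, φ z ≠ 0 ∧ φ z ≠ 1

namespace OmitsZeroOne

variable {φ : ℂ → ℂ}

theorem inv (hφ : OmitsZeroOne φ) : OmitsZeroOne fun z => (φ z)⁻¹ :=
  ⟨hφ.1.inv fun _ hz => (hφ.2 _ hz).1, fun z hz =>
    ⟨inv_ne_zero (hφ.2 z hz).1, inv_ne_one.2 (hφ.2 z hz).2⟩⟩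

theorem comp (hφ : OmitsZeroOne φ) {T : ℂ → ℂ} (hT : DifferentiableOn ℂ T (ball 0 1))
    (hm : MapsTo T (ball 0 1) (ball 0 1)) : OmitsZeroOne fun z => φ (T z) :=
  ⟨hφ.1.comp hT hm, fun _ hz => hφ.2 _ (hm hz)⟩

/-- **Schottky's theorem**. -/
theorem exists_norm_le {ρ : ℝ} (hρ : ρ < 1) (A : ℝ) : ∃ M, ∀ φ, OmitsZeroOne φ → ‖φ 0‖ ≤ A →
    ∀ z ∈ closedBall (0 : ℂ) ρ, ‖φ z‖ ≤ M := by
  set K := 3 + 2 * A + 48 / ((1 - ρ) / 2) * ρ with hK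
  refine ⟨(1 + Real.exp (Real.pi * Real.exp (Real.pi * K))) / 2, fun φ hφ hA z hz => ?_⟩
  have hne : ∀ z ∈ ball (0 : ℂ) 1, 2 * φ z - 1 ≠ 1 ∧ 2 * φ z - 1 ≠ -1 := fun z hz =>
    ⟨fun h => (hφ.2 z hz).2 (by linear_combination h / 2),
      fun h => (hφ.2 z hz).1 (by linear_combination h / 2)⟩
  obtain ⟨F, hF, hFe, hF0⟩ := exists_eqOn_cos ((hφ.1.const_mul 2).sub_const 1)
    (fun z hz => (hne z hz).1) (fun z hz => (hne z hz).2) one_pos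
  have hFn : ∀ z ∈ ball (0 : ℂ) 1, ∀ n : ℤ, F z ≠ n := fun z hz n h => by
    have h1 := hFe z hz
    have h2 : cos (Real.pi * F z) ^ 2 = 1 := by
      have := sin_sq_add_cos_sq (Real.pi * F z)
      rwa [h, mul_comm, sin_int_mul_pi, zero_pow two_ne_zero, zero_add, mul_comm, ← h] at this
    rw [← h1] at h2
    rcases sq_eq_sq_iff_eq_or_eq_neg.1 (h2.trans (one_pow 2).symm) with h | h
    · exact (hne z hz).1 h
    · exact (hne z hz).2 h
  obtain ⟨g, hg, hge, hg0⟩ := exists_eqOn_cos hF (fun z hz => by simpa using hFn z hz 1)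
    (fun z hz => by simpa using hFn z hz (-1)) one_pos
  have hz1 : ‖z‖ ≤ ρ := by simpa using hz
  have hρ0 : 0 ≤ ρ := (norm_nonneg z).trans hz1
  have hs : 0 < (1 - ρ) / 2 := by linarith
  have hgd : ∀ y ∈ closedBall (0 : ℂ) ρ, ‖deriv g y‖ ≤ 48 / ((1 - ρ) / 2) := fun y hy => by
    rw [le_div_iff₀ hs]
    refine norm_deriv_mul_le_of_omits hg (fun w => ?_) hs fun x hx => ?_
    · obtain ⟨p, hp, n, hn⟩ := exists_cos_eq_int w
      exact ⟨p, hp, fun x hx h => hFn x hx n (by rw [hge x hx, h, hn])⟩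
    · have h1 : dist y 0 ≤ ρ := hy
      have h2 : dist x y ≤ (1 - ρ) / 2 := hx
      have := dist_triangle x y 0
      rw [mem_ball]
      linarith
  have hball : closedBall (0 : ℂ) ρ ⊆ ball 0 1 := closedBall_subset_ball hρ
  have hgz : ‖g z‖ ≤ K := by
    have h1 := (convex_closedBall (0 : ℂ) ρ).norm_image_sub_le_of_norm_deriv_le
      (fun y hy => hg.differentiableAt (isOpen_ball.mem_nhds (hball hy))) hgd
      (mem_closedBall_self hρ0) hz
    have h2 : ‖g z‖ ≤ ‖g 0‖ + ‖g z - g 0‖ := by simpa using norm_add_le (g 0) (g z - g 0)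
    have h3 : ‖2 * φ 0 - 1‖ ≤ 2 * A + 1 := by
      refine (norm_sub_le _ _).trans ?_
      simp only [norm_mul, norm_ofNat, norm_one]
      linarith
    have h4 : 48 / ((1 - ρ) / 2) * ‖z - 0‖ ≤ 48 / ((1 - ρ) / 2) * ρ := by
      rw [sub_zero]; gcongr
    linarith
  have hnorm : ∀ (x : ℂ) (B : ℝ), ‖x‖ ≤ B → ‖cos (Real.pi * x)‖ ≤ Real.exp (Real.pi * B) :=
    fun x B hx => by
      refine (norm_cos_le_exp_norm _).trans (Real.exp_le_exp.2 ?_)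
      rw [norm_mul, norm_real, Real.norm_of_nonneg Real.pi_pos.le]
      exact mul_le_mul_of_nonneg_left hx Real.pi_pos.le
  have h1 : ‖2 * φ z - 1‖ ≤ Real.exp (Real.pi * Real.exp (Real.pi * K)) := by
    rw [hFe z (hball hz)]
    refine hnorm _ _ ?_
    rw [hge z (hball hz)]
    exact hnorm _ _ hgz
  have h2 : 2 * ‖φ z‖ ≤ ‖2 * φ z - 1‖ + 1 := by
    simpa using norm_add_le (2 * φ z - 1) 1
  linarith

/-- An omitting function which is small at `c` is small at the origin. -/
theorem exists_norm_zero_lt {c : ℂ} (hc : c ∈ ball (0 : ℂ) 1) {ε : ℝ} (hε : 0 < ε) :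
    ∃ δ > 0, ∀ φ, OmitsZeroOne φ → ‖φ c‖ < δ → ‖φ 0‖ < ε := by
  rw [mem_ball_zero_iff] at hc
  set ρ := (1 + ‖c‖) / 2 with hρ
  have hρ1 : ρ < 1 := by linarith
  have hcρ : ‖c‖ < ρ := by linarith
  have hρ0 : 0 < ρ := (norm_nonneg c).trans_lt hcρ
  obtain ⟨M₀, hM₀⟩ := exists_norm_le hρ1 1
  set M := max M₀ 2 with hM
  have hM1 : 1 < M := lt_of_lt_of_le one_lt_two (le_max_right _ _)
  have hM0 : 0 < M := zero_lt_one.trans hM1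
  have hm : 0 < Real.log M := Real.log_pos hM1
  set κ := 2 * ‖c‖ / (ρ - ‖c‖) with hκ
  have hκ0 : 0 ≤ κ := div_nonneg (by positivity) (by linarith)
  refine ⟨min (1 / M) (Real.exp ((1 + κ) * Real.log ε - κ * Real.log M)), by positivity,
    fun φ hφ hlt => ?_⟩
  have hcb : c ∈ closedBall (0 : ℂ) ρ := mem_closedBall_zero_iff.2 hcρ.le
  have hpos : ∀ z ∈ ball (0 : ℂ) 1, 0 < ‖φ z‖ := fun z hz => norm_pos_iff.2 (hφ.2 z hz).1
  have h0 : ‖φ 0‖ ≤ 1 := by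
    by_contra! h1
    have h2 := hM₀ _ hφ.inv (by rw [norm_inv]; exact inv_le_one_of_one_le₀ h1.le) c hcb
    rw [norm_inv] at h2
    have h3 := hlt.trans_le (min_le_left _ _)
    rw [one_div, lt_inv_comm₀ (hpos c (mem_ball_zero_iff.2 hc)) hM0] at h3
    exact absurd (h2.trans (le_max_left _ _)) (not_le.2 h3)
  obtain ⟨L, hL, hLe⟩ := exists_eqOn_exp (hφ.1.mono (ball_subset_ball hρ1.le))
    fun z hz => (hφ.2 z (ball_subset_ball hρ1.le hz)).1
  have hre : ∀ z ∈ ball (0 : ℂ) ρ, ‖φ z‖ = Real.exp (L z).re := fun z hz => by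
    rw [hLe z hz, norm_exp]
  have hm0 : (0 : ℂ) ∈ ball (0 : ℂ) ρ := mem_ball_self hρ0
  have hmc : c ∈ ball (0 : ℂ) ρ := mem_ball_zero_iff.2 hcρ
  have hL0 : (L 0).re ≤ 0 := by rwa [← Real.exp_le_one_iff, ← hre 0 hm0]
  have hBC := borelCaratheodory_zero (f := fun z => L z - L 0) (M := Real.log M - (L 0).re)
    (by linarith) (hL.sub_const _) (fun z hz => by
      have h1 := (hM₀ φ hφ h0 z (ball_subset_closedBall hz)).trans (le_max_left _ 2)
      rw [hre z hz, ← Real.le_log_iff_exp_le hM0] at h1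
      simp only [mem_ofPred_eq, sub_re]
      linarith) hρ0 hmc (sub_self _)
  have h1 : 2 * (Real.log M - (L 0).re) * ‖c‖ / (ρ - ‖c‖) = κ * (Real.log M - (L 0).re) := by
    rw [hκ]; ring
  rw [h1] at hBC
  have h2 := (abs_le.1 ((abs_re_le_norm _).trans hBC)).1
  rw [sub_re] at h2
  by_contra! hge
  have h3 : Real.log ε ≤ (L 0).re := by
    rwa [Real.log_le_iff_le_exp hε, ← hre 0 hm0]
  have h4 := hlt.trans_le (min_le_right _ _)
  rw [hre c hmc, Real.exp_lt_exp] at h4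
  have h5 := mul_le_mul_of_nonneg_left h3 (add_nonneg zero_le_one hκ0)
  linarith

/-- An omitting function which is small at the origin is small at `c`. -/
theorem exists_norm_lt {c : ℂ} (hc : c ∈ ball (0 : ℂ) 1) {ε : ℝ} (hε : 0 < ε) :
    ∃ δ > 0, ∀ φ, OmitsZeroOne φ → ‖φ 0‖ < δ → ‖φ c‖ < ε := by
  obtain ⟨T, hT, hTm, hT0, hTc⟩ := exists_swap_zero hc
  obtain ⟨δ, hδ, h⟩ := exists_norm_zero_lt hc hε
  refine ⟨δ, hδ, fun φ hφ hlt => ?_⟩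
  have := h _ (hφ.comp hT hTm)
  rw [hT0, hTc] at this
  exact this hlt

end OmitsZeroOne

end Schottky

section DisjointFamily

open Set Metric Topology Filter

theorem differentiableOn_of_tendsto_of_norm_le {ι : Type*} {l : Filter ι} [l.NeBot]
    {F : ι → ℂ → ℂ} {G : ℂ → ℂ} {U : Set ℂ} (hU : IsOpen U) {M : ℝ}
    (hF : ∀ᶠ i in l, DifferentiableOn ℂ (F i) U ∧ ∀ z ∈ U, ‖F i z‖ ≤ M)
    (hG : ∀ z ∈ U, Tendsto (fun i => F i z) l (𝓝 (G z))) : DifferentiableOn ℂ G U := by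
  refine TendstoLocallyUniformlyOn.differentiableOn (F := F) (φ := l) ?_ (hF.mono fun _ h => h.1) hU
  rw [Metric.tendstoLocallyUniformlyOn_iff]
  intro ε hε x hx
  obtain ⟨s, hs, hsU⟩ := Metric.isOpen_iff.1 hU x hx
  have hM : 0 ≤ M := by
    obtain ⟨i, hi⟩ := hF.exists
    exact (norm_nonneg _).trans (hi.2 x hx)
  have hlip : ∀ᶠ i in l, ∀ y ∈ ball x s, dist (F i y) (F i x) ≤ 2 * M / s * dist y x := by
    filter_upwards [hF] with i hi y hy
    refine Complex.dist_le_div_mul_dist_of_mapsTo_ball (hi.1.mono hsU) (fun z hz => ?_) hy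
    rw [mem_closedBall, dist_eq_norm]
    linarith [norm_sub_le (F i z) (F i x), hi.2 z (hsU hz), hi.2 x hx]
  have hlipG : ∀ y ∈ ball x s, dist (G y) (G x) ≤ 2 * M / s * dist y x := fun y hy =>
    le_of_tendsto ((hG y (hsU hy)).dist (hG x hx)) (hlip.mono fun i hi => hi y hy)
  set η := min s (ε / (3 * (2 * M / s + 1))) with hη
  have hη0 : 0 < η := by positivity
  have hsmall : ∀ y ∈ ball x η, 2 * M / s * dist y x < ε / 3 := fun y hy => by
    have h1 : dist y x ≤ ε / (3 * (2 * M / s + 1)) := (mem_ball.1 hy).le.trans (min_le_right _ _)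
    rw [le_div_iff₀ (by positivity)] at h1
    by_cases h2 : dist y x = 0
    · rw [h2, mul_zero]; positivity
    · have h3 : 0 < dist y x := lt_of_le_of_ne dist_nonneg (Ne.symm h2)
      linarith
  refine ⟨ball x η, mem_nhdsWithin_of_mem_nhds (ball_mem_nhds x hη0), ?_⟩
  filter_upwards [hlip, (Metric.tendsto_nhds.1 (hG x hx)) (ε / 3) (by positivity)] with i h1 h2 y hy
  have hy' : y ∈ ball x s := ball_subset_ball (min_le_left _ _) hy
  have h3 := (h1 y hy').trans_lt (hsmall y hy)
  have h4 := (hlipG y hy').trans_lt (hsmall y hy)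
  have h5 := dist_triangle4 (G y) (G x) (F i x) (F i y)
  rw [dist_comm (G x), dist_comm (F i x) (F i y)] at h5
  linarith

/-- An omitting function with prescribed value at one point is locally uniformly bounded. -/
theorem OmitsZeroOne.exists_norm_le_of_eq {c : ℂ} (hc : c ∈ ball (0 : ℂ) 1) {ρ : ℝ} (hρ : ρ < 1)
    (p : ℂ) : ∃ M, ∀ φ, OmitsZeroOne φ → φ c = p → ∀ z ∈ closedBall (0 : ℂ) ρ, ‖φ z‖ ≤ M := by
  by_cases hp : p = 0
  · exact ⟨0, fun φ hφ h => absurd (h.trans hp) (hφ.2 c hc).1⟩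
  obtain ⟨δ, hδ, h⟩ := OmitsZeroOne.exists_norm_lt hc (norm_pos_iff.2 (inv_ne_zero hp))
  obtain ⟨M, hM⟩ := OmitsZeroOne.exists_norm_le hρ δ⁻¹
  refine ⟨M, fun φ hφ hpc => hM φ hφ ?_⟩
  by_contra! hlt
  have h1 := h _ hφ.inv (by rw [norm_inv]; exact inv_lt_of_inv_lt₀ hδ hlt)
  rw [hpc] at h1
  exact h1.false

theorem exists_norm_sub_le {f₁ f₂ : ℂ → ℂ} (h₁ : DifferentiableOn ℂ f₁ (ball 0 1))
    (h₂ : DifferentiableOn ℂ f₂ (ball 0 1)) (hd : ∀ c ∈ ball (0 : ℂ) 1, f₁ c ≠ f₂ c) {c₀ : ℂ}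
    (hc₀ : c₀ ∈ ball (0 : ℂ) 1) (w : ℂ) {ρ : ℝ} (hρ : ρ < 1) :
    ∃ r < 1, ∃ M, ∀ g, DifferentiableOn ℂ g (ball 0 r) → g c₀ = w →
      (∀ c ∈ ball 0 r, g c ≠ f₁ c ∧ g c ≠ f₂ c) → ∀ z ∈ closedBall (0 : ℂ) ρ,
        ‖g z - f₁ z‖ ≤ M * ‖f₂ z - f₁ z‖ ∧ ‖f₂ z - f₁ z‖ ≤ M * ‖g z - f₁ z‖ := by
  obtain ⟨r, hr, hr1⟩ := exists_between (max_lt (max_lt hρ (mem_ball_zero_iff.1 hc₀)) one_pos)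
  obtain ⟨⟨hρr, hcr⟩, hr0⟩ := by simpa only [max_lt_iff] using hr
  have hmem : ∀ z : ℂ, ‖z‖ < r → z / r ∈ ball (0 : ℂ) 1 := fun z hz => by
    rw [mem_ball_zero_iff, norm_div, Complex.norm_real, Real.norm_of_nonneg hr0.le,
      div_lt_one hr0]
    exact hz
  have hmap : MapsTo (fun z : ℂ => (r : ℂ) * z) (ball 0 1) (ball 0 r) := fun z hz => by
    rw [mem_ball_zero_iff] at hz ⊢
    rw [norm_mul, Complex.norm_real, Real.norm_of_nonneg hr0.le]
    exact mul_lt_of_lt_one_right hr0 hz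
  have hrc : (r : ℂ) ≠ 0 := Complex.ofReal_ne_zero.2 hr0.ne'
  have hρr' : ρ / r < 1 := (div_lt_one hr0).2 hρr
  have hsub : ball (0 : ℂ) r ⊆ ball 0 1 := ball_subset_ball hr1.le
  set p := (w - f₁ c₀) / (f₂ c₀ - f₁ c₀) with hp
  obtain ⟨M₁, hM₁⟩ := OmitsZeroOne.exists_norm_le_of_eq (hmem c₀ hcr) hρr' p
  obtain ⟨M₂, hM₂⟩ := OmitsZeroOne.exists_norm_le_of_eq (hmem c₀ hcr) hρr' p⁻¹
  refine ⟨r, hr1, max M₁ M₂, fun g hg hgc hgd z hz => ?_⟩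
  have hφ : OmitsZeroOne fun z => (g (r * z) - f₁ (r * z)) / (f₂ (r * z) - f₁ (r * z)) := by
    have hne : ∀ z ∈ ball (0 : ℂ) 1, f₂ (r * z) - f₁ (r * z) ≠ 0 := fun z hz =>
      sub_ne_zero.2 (hd _ (hsub (hmap hz))).symm
    have hm : DifferentiableOn ℂ (fun z : ℂ => (r : ℂ) * z) (ball 0 1) := by fun_prop
    refine ⟨((hg.comp hm hmap).sub ((h₁.mono hsub).comp hm hmap)).div
      (((h₂.mono hsub).comp hm hmap).sub ((h₁.mono hsub).comp hm hmap)) hne, fun z hz =>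
      ⟨div_ne_zero (sub_ne_zero.2 (hgd _ (hmap hz)).1) (hne z hz), fun h => ?_⟩⟩
    rw [div_eq_one_iff_eq (hne z hz)] at h
    exact (hgd _ (hmap hz)).2 (sub_left_injective h)
  have hz1 : ‖z‖ < r := (mem_closedBall_zero_iff.1 hz).trans_lt hρr
  have hz' : z / r ∈ closedBall (0 : ℂ) (ρ / r) := by
    rw [mem_closedBall_zero_iff] at hz ⊢
    rw [norm_div, Complex.norm_real, Real.norm_of_nonneg hr0.le]
    gcongr
  have hc' : (r : ℂ) * (c₀ / r) = c₀ := mul_div_cancel₀ _ hrc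
  have hzr : (r : ℂ) * (z / r) = z := mul_div_cancel₀ _ hrc
  have h3 := (hM₁ _ hφ (by simp only [hc', hgc, hp]) _ hz').trans (le_max_left M₁ M₂)
  have h4 := (hM₂ _ hφ.inv (by simp only [hc', hgc, hp]) _ hz').trans (le_max_right M₁ M₂)
  have hzb := mem_ball_zero_iff.2 hz1
  simp only [hzr] at h3 h4
  rw [norm_div, div_le_iff₀ (norm_pos_iff.2 (sub_ne_zero.2 (hd z (hsub hzb)).symm))] at h3
  rw [inv_div, norm_div, div_le_iff₀ (norm_pos_iff.2 (sub_ne_zero.2 (hgd z hzb).1))] at h4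
  exact ⟨h3, h4⟩

/-- A family of holomorphic functions on the unit disk with pairwise disjoint graphs. -/
def IsDisjointFamily (S : Set (ℂ → ℂ)) : Prop :=
  (∀ f ∈ S, DifferentiableOn ℂ f (ball 0 1)) ∧
    S.Pairwise fun f g => ∀ c ∈ ball (0 : ℂ) 1, f c ≠ g c

theorem IsDisjointFamily.exists_ultrafilter {S : Set (ℂ → ℂ)} (hS : IsDisjointFamily S) {c₀ w : ℂ}
    (hc₀ : c₀ ∈ ball (0 : ℂ) 1) (hw : ∀ f ∈ S, w ≠ f c₀) :
    ∃ l : Ultrafilter (ℂ → ℂ), (∀ᶠ g in (l : Filter (ℂ → ℂ)), g c₀ = w) ∧ ∀ r < 1,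
      (∀ᶠ g in (l : Filter (ℂ → ℂ)), DifferentiableOn ℂ g (ball 0 r)) ∧
      ∀ f ∈ S, ∀ᶠ g in (l : Filter (ℂ → ℂ)), ∀ c ∈ ball 0 r, g c ≠ f c := by
  classical
  have hex : ∀ i : Finset S × {r : ℝ // ‖c₀‖ < r ∧ r < 1}, ∃ g : ℂ → ℂ,
      DifferentiableOn ℂ g (ball 0 i.2) ∧ g c₀ = w ∧ ∀ f ∈ i.1, ∀ c ∈ ball 0 (i.2 : ℝ),
        g c ≠ (f : ℂ → ℂ) c := fun i => by
    obtain ⟨g, h1, h2, h3⟩ := exists_avoiding_of_finite (ι := i.1) (f := fun f => f.1.1)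
      (fun f => hS.1 _ f.1.2)
      (fun f f' hff => hS.2 f.1.2 f'.1.2 fun h => hff (Subtype.ext (Subtype.ext h)))
      i.2.2.2 (mem_ball_zero_iff.2 i.2.2.1) (fun f => hw _ f.1.2)
    exact ⟨g, h1, h2, fun f hf => h3 ⟨f, hf⟩⟩
  choose g hgd hgc hgf using hex
  have : Nonempty {r : ℝ // ‖c₀‖ < r ∧ r < 1} := by
    obtain ⟨r, h⟩ := exists_between (mem_ball_zero_iff.1 hc₀)
    exact ⟨⟨r, h⟩⟩
  have hat : ∀ {P : (ℂ → ℂ) → Prop}, (∀ᶠ i in atTop, P (g i)) →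
      ∀ᶠ h in ((Ultrafilter.of atTop).map g : Filter (ℂ → ℂ)), P h := fun h =>
    eventually_map.2 (h.filter_mono (Ultrafilter.of_le _))
  have hrad : ∀ r < (1 : ℝ), ∀ T : Finset S, ∀ᶠ i : Finset S × {r : ℝ // ‖c₀‖ < r ∧ r < 1} in atTop,
      T ⊆ i.1 ∧ r ≤ i.2 := fun r hr T => by
    obtain ⟨r', h1, h2⟩ := exists_between (max_lt hr (mem_ball_zero_iff.1 hc₀))
    rw [max_lt_iff] at h1
    filter_upwards [eventually_ge_atTop (T, ⟨r', h1.2, h2⟩)] with i hi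
    exact ⟨hi.1, h1.1.le.trans hi.2⟩
  refine ⟨(Ultrafilter.of atTop).map g, hat (.of_forall hgc), fun r hr => ⟨hat ?_, fun f hf =>
    hat ?_⟩⟩
  · filter_upwards [hrad r hr ∅] with i hi
    exact (hgd i).mono (ball_subset_ball hi.2)
  · filter_upwards [hrad r hr {⟨f, hf⟩}] with i hi c hc
    exact hgf i ⟨f, hf⟩ (hi.1 (Finset.mem_singleton_self _)) c (ball_subset_ball hi.2 hc)

/-- Through every point off the graphs of a disjoint family there passes a graph disjoint from
all of them. -/
theorem IsDisjointFamily.exists_avoiding {S : Set (ℂ → ℂ)} (hS : IsDisjointFamily S) {c₀ w : ℂ}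
    (hc₀ : c₀ ∈ ball (0 : ℂ) 1) (hw : ∀ f ∈ S, w ≠ f c₀) :
    ∃ g, DifferentiableOn ℂ g (ball 0 1) ∧ g c₀ = w ∧
      ∀ f ∈ S, ∀ c ∈ ball (0 : ℂ) 1, g c ≠ f c := by
  rcases S.subsingleton_or_nontrivial with hs | hs
  · rcases S.eq_empty_or_nonempty with rfl | ⟨f, hf⟩
    · exact ⟨fun _ => w, differentiableOn_const _, rfl, by simp⟩
    · refine ⟨fun c => f c + (w - f c₀), (hS.1 f hf).add_const _, by ring, fun f' hf' c _ h => ?_⟩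
      rw [hs hf' hf, add_eq_left] at h
      exact hw f hf (sub_eq_zero.1 h)
  obtain ⟨f₁, hf₁, f₂, hf₂, hne⟩ := hs
  obtain ⟨l, hlw, hl⟩ := hS.exists_ultrafilter hc₀ hw
  have hquot : ∀ f ∈ S, ∀ f' ∈ S, f ≠ f' → ∀ ρ < 1, ∃ M, ∀ᶠ g in (l : Filter (ℂ → ℂ)),
      ∀ z ∈ closedBall (0 : ℂ) ρ, ‖g z - f z‖ ≤ M * ‖f' z - f z‖ ∧
        ‖f' z - f z‖ ≤ M * ‖g z - f z‖ := fun f hf f' hf' hff ρ hρ => by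
    obtain ⟨r, hr, M, hM⟩ := exists_norm_sub_le (hS.1 f hf) (hS.1 f' hf') (hS.2 hf hf' hff) hc₀ w hρ
    refine ⟨M, ?_⟩
    filter_upwards [hlw, (hl r hr).1, (hl r hr).2 f hf, (hl r hr).2 f' hf'] with g h1 h2 h3 h4
    exact hM g h2 h1 fun c hc => ⟨h3 c hc, h4 c hc⟩
  have hbdd : ∀ ρ < 1, ∃ B, ∀ᶠ g in (l : Filter (ℂ → ℂ)), ∀ z ∈ closedBall (0 : ℂ) ρ, ‖g z‖ ≤ B :=
    fun ρ hρ => by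
      obtain ⟨M, hM⟩ := hquot f₁ hf₁ f₂ hf₂ hne ρ hρ
      have hsub : closedBall (0 : ℂ) ρ ⊆ ball 0 1 := closedBall_subset_ball hρ
      have c1 := (hS.1 f₁ hf₁).continuousOn.mono hsub
      have c2 := (hS.1 f₂ hf₂).continuousOn.mono hsub
      obtain ⟨B, hB⟩ := (isCompact_closedBall (0 : ℂ) ρ).exists_bound_of_continuousOn
        (((c2.sub c1).norm.const_mul M).add c1.norm)
      refine ⟨B, hM.mono fun g hg z hz => ?_⟩
      have h1 := (Real.le_norm_self _).trans (hB z hz)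
      have h2 : ‖g z‖ ≤ ‖g z - f₁ z‖ + ‖f₁ z‖ := by
        simpa using norm_add_le (g z - f₁ z) (f₁ z)
      exact (h2.trans (add_le_add_left (hg z hz).1 _)).trans h1
  have hlim : ∀ z : ℂ, ∃ y, z ∈ ball (0 : ℂ) 1 → Tendsto (fun g : ℂ → ℂ => g z) l (𝓝 y) := fun z => by
    by_cases hz : z ∈ ball (0 : ℂ) 1
    · obtain ⟨B, hB⟩ := hbdd ‖z‖ (mem_ball_zero_iff.1 hz)
      obtain ⟨y, -, hy⟩ := (isCompact_closedBall (0 : ℂ) B).ultrafilter_le_nhds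
        (l.map fun g : ℂ → ℂ => g z) (by
          rw [le_principal_iff]
          exact hB.mono fun g hg => mem_closedBall_zero_iff.2 (hg z (by simp)))
      exact ⟨y, fun _ => hy⟩
    · exact ⟨0, fun h => absurd h hz⟩
  choose G hG using hlim
  refine ⟨G, fun z hz => ?_, ?_, fun f hf z hz h => ?_⟩
  · obtain ⟨r, h1, h2⟩ := exists_between (mem_ball_zero_iff.1 hz)
    obtain ⟨B, hB⟩ := hbdd r h2
    have := differentiableOn_of_tendsto_of_norm_le (F := fun g : ℂ → ℂ => g) (G := G) (M := B)
      (l := (l : Filter (ℂ → ℂ))) (isOpen_ball (x := (0 : ℂ)) (ε := r))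
      (((hl r h2).1.and hB).mono fun g hg =>
        ⟨hg.1, fun z hz => hg.2 z (ball_subset_closedBall hz)⟩)
      fun z hz => hG z (ball_subset_ball h2.le hz)
    exact (this.differentiableAt
      (isOpen_ball.mem_nhds (mem_ball_zero_iff.2 h1))).differentiableWithinAt
  · exact tendsto_nhds_unique (hG c₀ hc₀) (tendsto_const_nhds.congr' (hlw.mono fun g hg => hg.symm))
  · obtain ⟨f', hf', hff⟩ : ∃ f' ∈ S, f ≠ f' := by
      by_cases h1 : f = f₁
      · exact ⟨f₂, hf₂, h1 ▸ hne⟩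
      · exact ⟨f₁, hf₁, h1⟩
    obtain ⟨M, hM⟩ := hquot f hf f' hf' hff ‖z‖ (mem_ball_zero_iff.1 hz)
    have h1 := ge_of_tendsto (((hG z hz).sub_const (f z)).norm.const_mul M)
      (hM.mono fun g hg => (hg z (by simp)).2)
    rw [h, sub_self, norm_zero, mul_zero, norm_le_zero_iff, sub_eq_zero] at h1
    exact hS.2 hf hf' hff z hz h1.symm

/-- A disjoint family extends to one whose graphs fill the product of the disk and the plane. -/
theorem IsDisjointFamily.exists_superset {S : Set (ℂ → ℂ)} (hS : IsDisjointFamily S) :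
    ∃ T, S ⊆ T ∧ IsDisjointFamily T ∧ ∀ c ∈ ball (0 : ℂ) 1, ∀ w, ∃ f ∈ T, f c = w := by
  obtain ⟨T, hST, hT⟩ := zorn_subset_nonempty {T | IsDisjointFamily T} (fun C hC hchain _ =>
    ⟨⋃₀ C, ⟨fun f ⟨s, hs, hf⟩ => (hC hs).1 f hf,
      (pairwise_sUnion hchain.directedOn).2 fun s hs => (hC hs).2⟩,
      fun s hs => subset_sUnion_of_mem hs⟩) S hS
  refine ⟨T, hST, hT.prop, fun c hc w => ?_⟩
  by_contra! h
  obtain ⟨g, hg, hgw, hgT⟩ := hT.prop.exists_avoiding hc fun f hf => (h f hf).symm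
  have hins : IsDisjointFamily (insert g T) :=
    ⟨forall_mem_insert.2 ⟨hg, hT.prop.1⟩, hT.prop.2.insert fun f hf _ =>
      ⟨hgT f hf, fun c hc => (hgT f hf c hc).symm⟩⟩
  exact h g (hT.le_of_ge hins (subset_insert g T) (mem_insert g T)) hgw

theorem IsDisjointFamily.omitsZeroOne {S : Set (ℂ → ℂ)} (hS : IsDisjointFamily S) {f g k : ℂ → ℂ}
    (hf : f ∈ S) (hg : g ∈ S) (hk : k ∈ S) (hgf : g ≠ f) (hkf : k ≠ f) (hgk : g ≠ k) :
    OmitsZeroOne fun c => (g c - f c) / (k c - f c) := by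
  have hne : ∀ c ∈ ball (0 : ℂ) 1, k c - f c ≠ 0 := fun c hc =>
    sub_ne_zero.2 (hS.2 hk hf hkf c hc)
  refine ⟨((hS.1 g hg).sub (hS.1 f hf)).div ((hS.1 k hk).sub (hS.1 f hf)) hne, fun c hc =>
    ⟨div_ne_zero (sub_ne_zero.2 (hS.2 hg hf hgf c hc)) (hne c hc), fun h => ?_⟩⟩
  rw [div_eq_one_iff_eq (hne c hc)] at h
  exact hS.2 hg hk hgk c hc (sub_left_injective h)

end DisjointFamily

/-- Slodkowski's theorem (holomorphic motion theorem, planar form): a holomorphic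
motion of `E ⊆ ℂ` extends to a holomorphic motion of all of `ℂ`, and for each
parameter `c` in the unit disk the extended motion is a homeomorphism of `ℂ`. -/
theorem holomorphicMotion_extension (E : Set ℂ) (h : ℂ → ℂ → ℂ)
    (hh : IsHolomorphicMotion E h) :
    ∃ H : ℂ → ℂ → ℂ, IsHolomorphicMotion Set.univ H ∧
      (∀ c ∈ Metric.ball (0 : ℂ) 1, ∀ z ∈ E, H c z = h c z) ∧
      (∀ c ∈ Metric.ball (0 : ℂ) 1, ∃ φ : ℂ ≃ₜ ℂ, ∀ z : ℂ, φ z = H c z) := by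
  obtain ⟨h0, hinj, hdiff⟩ := hh
  obtain ⟨S, hES, hS, hfill⟩ := IsDisjointFamily.exists_superset
    (S := (fun z c => h c z) '' E) ⟨by rintro _ ⟨z, hz, rfl⟩; exact hdiff z hz, by
      rintro _ ⟨z, hz, rfl⟩ _ ⟨z', hz', rfl⟩ hne c hc heq
      exact hne (by rw [hinj c hc hz hz' heq])⟩
  have hzero : (0 : ℂ) ∈ Metric.ball (0 : ℂ) 1 := Metric.mem_ball_self one_pos
  have huniq : ∀ c ∈ Metric.ball (0 : ℂ) 1, ∀ f ∈ S, ∀ g ∈ S, f c = g c → f = g :=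
    fun c hc f hf g hg hfg => by
      by_contra hne
      exact hS.2 hf hg hne c hc hfg
  choose F hFS hF0 using hfill 0 hzero
  have hinjF : ∀ c ∈ Metric.ball (0 : ℂ) 1, Function.Injective fun z => F z c := fun c hc z z' hz => by
    rw [← hF0 z, ← hF0 z', huniq c hc _ (hFS z) _ (hFS z') hz]
  have hF : ∀ f ∈ S, F (f 0) = f := fun f hf => huniq 0 hzero _ (hFS _) f hf (hF0 _)
  have hbij : ∀ c ∈ Metric.ball (0 : ℂ) 1, Function.Bijective fun z => F z c := fun c hc =>
    ⟨hinjF c hc, fun w => by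
      obtain ⟨f, hf, hfw⟩ := hfill c hc w
      exact ⟨f 0, by simp only [hF f hf, hfw]⟩⟩
  have hFne : ∀ {z z'}, z ≠ z' → F z ≠ F z' := fun {z z'} hne heq =>
    hne (by rw [← hF0 z, heq, hF0])
  have hom : ∀ z z', z' ≠ z → z' ≠ z + 1 →
      OmitsZeroOne fun c => (F z' c - F z c) / (F (z + 1) c - F z c) := fun z z' h1 h2 =>
    hS.omitsZeroOne (hFS z) (hFS z') (hFS (z + 1)) (hFne h1) (hFne (by simp)) (hFne h2)
  refine ⟨fun c z => F z c, ⟨fun z _ => hF0 z, fun c hc => (hinjF c hc).injOn,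
    fun z _ => hS.1 _ (hFS z)⟩, fun c _ z hz => ?_, fun c hc => ?_⟩
  · have := hF _ (hES (Set.mem_image_of_mem _ hz))
    simp only [h0 z hz] at this
    simp only [this]
  have hpos : ∀ z, 0 < ‖F (z + 1) c - F z c‖ := fun z =>
    norm_pos_iff.2 (sub_ne_zero.2 fun heq => by simpa using hinjF c hc heq)
  refine ⟨⟨Equiv.ofBijective _ (hbij c hc), ?_, ?_⟩, fun z => rfl⟩
  · refine Metric.continuous_iff.2 fun z ε hε => ?_
    obtain ⟨δ, hδ, hlt⟩ := OmitsZeroOne.exists_norm_lt hc (div_pos hε (hpos z))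
    refine ⟨min δ 1, by positivity, fun z' hz' => ?_⟩
    rw [dist_eq_norm, lt_min_iff] at hz'
    rcases eq_or_ne z' z with rfl | hne
    · simpa using hε
    have := hlt _ (hom z z' hne fun heq => by simp [heq] at hz') (by simpa [hF0] using hz'.1)
    rw [norm_div, div_lt_div_iff_of_pos_right (hpos z)] at this
    simpa [dist_eq_norm] using this
  · refine Metric.continuous_iff.2 fun w ε hε => ?_
    obtain ⟨z, rfl⟩ := (hbij c hc).2 w
    obtain ⟨δ, hδ, hlt⟩ := OmitsZeroOne.exists_norm_zero_lt hc hε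
    refine ⟨min (δ * ‖F (z + 1) c - F z c‖) ‖F (z + 1) c - F z c‖,
      lt_min (mul_pos hδ (hpos z)) (hpos z), fun w' hw' => ?_⟩
    obtain ⟨z', rfl⟩ := (hbij c hc).2 w'
    have hinv : ∀ y, (Equiv.ofBijective _ (hbij c hc)).symm (F y c) = y :=
      (Equiv.ofBijective _ (hbij c hc)).symm_apply_apply
    change dist ((Equiv.ofBijective _ (hbij c hc)).symm (F z' c))
      ((Equiv.ofBijective _ (hbij c hc)).symm (F z c)) < ε
    rw [hinv, hinv]
    rw [dist_eq_norm, lt_min_iff] at hw'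
    rcases eq_or_ne z' z with rfl | hne
    · simpa using hε
    have := hlt _ (hom z z' hne fun heq => by simp [heq] at hw')
      (by rw [norm_div, div_lt_iff₀ (hpos z)]; exact hw'.1)
    simpa [hF0, dist_eq_norm] using this
end
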